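/- arXiv:math/0002186 — 3 statements merged into one kernel-verified Lean document; each statement's English description precedes it below -/
import Mathlib

section
/- Let H : (ℂ^N,0) → (ℂ^N,0) be an invertible germ of a holomorphic map and (M,0), (M',0) germs at 0 of real-analytic submanifolds of ℂ^N of the same dimension and codimension d. Then for any integer k > 1 the following are equivalent: (i) H is a k-equivalence between (M,0) and (M',0); (ii) there exist local parametrizations Z(x) and Z'(x) at 0 of M and M' respectively with Z'(x) = H(Z(x)) + O(|x|^k); (iii) for every local parametrization Z(x) of M at 0 there exists a local parametrization Z'(x) of M' at 0 with Z'(x) = H(Z(x)) + O(|x|^k); (iv) there exist local defining functions ρ of M and ρ' of M' near 0 with ρ'(H(Z), H̄(ζ)) = ρ(Z,ζ) + O(|(Z,ζ)|^k); (v) for every local defining function ρ of M near 0 there exists a local defining function ρ' of M' near 0 with ρ'(H(Z), H̄(ζ)) = ρ(Z,ζ) + O(|(Z,ζ)|^k); (vi) for any local defining functions ρ of M and ρ' of M' near 0, there exists a holomorphic function a(Z,ζ) near 0 in ℂ^{2N} with values in the invertible d×d matrices such that ρ'(H(Z), H̄(ζ)) = a(Z,ζ)ρ(Z,ζ) + O(|(Z,ζ)|^k).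 In particular, inverses and compositions of k-equivalences are k-equivalences. -/
open scoped BigOperators
open Complex

noncomputable section

abbrev Cn (N : ℕ) : Type := Fin N → ℂ
abbrev Rn (m : ℕ) : Type := Fin m → ℝ

/-- A local defining function for `M` near `p`. -/
def IsDefiningFun (N d : ℕ) (M : Set (Cn N)) (p : Cn N)
    (U : Set (Cn N)) (ρ : Cn N → Rn d) : Prop :=
  IsOpen U ∧ p ∈ U ∧ AnalyticOnNhd ℝ ρ U ∧
  (∀ z ∈ U, (z ∈ M ↔ ρ z = 0)) ∧
  ∀ z ∈ U, Function.Surjective (fderiv ℝ ρ z)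

/-- `M` is a real-analytic submanifold of `ℂ^N` of (real) codimension `d`. -/
def IsRASubmanifold (N d : ℕ) (M : Set (Cn N)) : Prop :=
  ∀ p ∈ M, ∃ U ρ, IsDefiningFun N d M p U ρ

/-- A real-analytic local parametrization of `M` (of codimension `d`) at `p`. -/
def IsLocalParam (N d : ℕ) (M : Set (Cn N)) (p : Cn N)
    (Ω : Set (Rn (2*N - d))) (Z : Rn (2*N - d) → Cn N) : Prop :=
  IsOpen Ω ∧ (0 : Rn (2*N-d)) ∈ Ω ∧ Z 0 = p ∧ AnalyticOnNhd ℝ Z Ω ∧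
  Set.InjOn Z Ω ∧ (∀ x ∈ Ω, Function.Injective (fderiv ℝ Z x)) ∧
  ∃ U : Set (Cn N), IsOpen U ∧ p ∈ U ∧ Z '' Ω = M ∩ U

/-- `H` is a `k`-equivalence between `(M,p)` and `(M',p')`. -/
def IsKEquivalence (N d : ℕ) (M M' : Set (Cn N)) (p p' : Cn N) (k : ℕ)
    (H : Cn N → Cn N) : Prop :=
  AnalyticAt ℂ H p ∧ H p = p' ∧ Function.Bijective (fderiv ℂ H p) ∧
  ∃ Ω Z, IsLocalParam N d M p Ω Z ∧
    ∀ U' ρ', IsDefiningFun N d M' p' U' ρ' →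
      ∃ C ε : ℝ, 0 < ε ∧ ∀ x : Rn (2*N - d), ‖x‖ < ε →
        ‖ρ' (H (Z x))‖ ≤ C * ‖x‖ ^ k

/-- `H` is a biholomorphic equivalence between `(M,p)` and `(M',p')`. -/
def IsBiholEquivalence (N : ℕ) (M M' : Set (Cn N)) (p p' : Cn N)
    (H : Cn N → Cn N) : Prop :=
  ∃ (U U' : Set (Cn N)) (Hinv : Cn N → Cn N),
    IsOpen U ∧ IsOpen U' ∧ p ∈ U ∧ p' ∈ U' ∧ H p = p' ∧
    AnalyticOnNhd ℂ H U ∧ AnalyticOnNhd ℂ Hinv U' ∧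
    Set.BijOn H U U' ∧ (∀ z ∈ U, Hinv (H z) = z) ∧
    H '' (M ∩ U) = M' ∩ U'

/-- `V` is a real-analytic subvariety of `M`: closed in `M` and locally the common zero
set of finitely many real-valued real-analytic functions. -/
def IsRASubvarietyOf (N : ℕ) (M V : Set (Cn N)) : Prop :=
  V ⊆ M ∧ (∃ C : Set (Cn N), IsClosed C ∧ V = M ∩ C) ∧
  ∀ p ∈ M, ∃ (U : Set (Cn N)) (m : ℕ) (f : Fin m → (Cn N → ℝ)),
    IsOpen U ∧ p ∈ U ∧ (∀ i, AnalyticOnNhd ℝ (f i) U) ∧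
    V ∩ U = {z ∈ M ∩ U | ∀ i, f i z = 0}

/-- Componentwise complex conjugation on `ℂ^N`. -/
def conjV (N : ℕ) (z : Cn N) : Cn N := fun i => (starRingEnd ℂ) (z i)

/-- The germ `H̄` whose power series coefficients are the complex conjugates of those
of `H`: `H̄(ζ) = conj (H (conj ζ))`. -/
def conjMap (N : ℕ) (H : Cn N → Cn N) : Cn N → Cn N :=
  fun ζ => conjV N (H (conjV N ζ))

/-- `P` is a holomorphic complexification at `0` of the real-analytic map `ρ`:
`P(Z,ζ)` is holomorphic near `(0,0)` and `P(Z, Z̄) = ρ(Z, Z̄)`. -/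
def IsComplexification (N d : ℕ) (ρ : Cn N → Rn d) (P : Cn N × Cn N → Fin d → ℂ) : Prop :=
  AnalyticAt ℂ P (0, 0) ∧
  ∃ ε : ℝ, 0 < ε ∧ ∀ z : Cn N, ‖z‖ < ε → ∀ j, P (z, conjV N z) j = ((ρ z j : ℝ) : ℂ)

open Filter Topology Asymptotics in
/-- Analytic inverse function theorem. -/
theorem AnalyticAt.exists_local_inverse {𝕜 E F : Type} [RCLike 𝕜]
    [NormedAddCommGroup E] [NormedSpace 𝕜 E] [CompleteSpace E]
    [NormedAddCommGroup F] [NormedSpace 𝕜 F] [CompleteSpace F]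
    {f : E → F} {x : E} (hf : AnalyticAt 𝕜 f x)
    (hb : Function.Bijective (fderiv 𝕜 f x)) :
    ∃ g : F → E, AnalyticAt 𝕜 g (f x) ∧ g (f x) = x ∧
      (∀ᶠ z in 𝓝 x, g (f z) = z) ∧ ∀ᶠ y in 𝓝 (f x), f (g y) = y := by
  let e : E ≃L[𝕜] F := ContinuousLinearEquiv.ofBijective (fderiv 𝕜 f x)
    (LinearMap.ker_eq_bot.2 hb.1) (LinearMap.range_eq_top.2 hb.2)
  have he : (e : E →L[𝕜] F) = fderiv 𝕜 f x := ContinuousLinearEquiv.coe_ofBijective _ _ _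
  have hs : HasStrictFDerivAt f (e : E →L[𝕜] F) x := by
    rw [he]; exact hf.hasStrictFDerivAt
  let φ := hs.toOpenPartialHomeomorph f
  have hx : x ∈ φ.source := hs.mem_toOpenPartialHomeomorph_source
  exact ⟨φ.symm, φ.analyticAt_symm' hx hf he.symm, φ.left_inv hx,
    φ.eventually_left_inverse hx, φ.eventually_right_inverse' hx⟩

open Filter Topology in
/-- A geometrically bounded family of coefficients, evaluated on finitely many linear forms,
defines an analytic function. -/
theorem exists_analyticAt_hasSum_prod_smul {ι G W : Type} [Fintype ι]
    [NormedAddCommGroup G] [NormedSpace ℂ G] [CompleteSpace G]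
    [NormedAddCommGroup W] [NormedSpace ℂ W]
    (c : ∀ n : ℕ, (Fin n → ι) → G) {C r : ℝ} (hC : 0 ≤ C) (hr : 0 ≤ r)
    (hc : ∀ n I, ‖c n I‖ ≤ C * r ^ n) (l : ι → W →L[ℂ] ℂ) :
    ∃ Q : W → G, AnalyticAt ℂ Q 0 ∧
      ∀ᶠ w in 𝓝 (0 : W), HasSum (fun n => ∑ I, (∏ j : Fin n, l (I j) w) • c n I) (Q w) := by
  classical
  let p : FormalMultilinearSeries ℂ W G := fun n =>
    ∑ I, (ContinuousMultilinearMap.mkPiRing ℂ (Fin n) (c n I)).compContinuousLinearMap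
      (fun j => l (I j))
  let K : ℝ := ∑ i, ‖l i‖
  have hK : ∀ i, ‖l i‖ ≤ K := fun i =>
    Finset.single_le_sum (f := fun i => ‖l i‖) (fun _ _ => norm_nonneg _) (Finset.mem_univ i)
  have hK0 : 0 ≤ K := Finset.sum_nonneg fun _ _ => norm_nonneg _
  let m : ℝ := Fintype.card ι
  have hm : 0 ≤ m := Nat.cast_nonneg _
  have hp : ∀ n, ‖p n‖ ≤ C * (m * r * K) ^ n := by
    intro n
    calc ‖p n‖ ≤ ∑ I : Fin n → ι, C * r ^ n * K ^ n := by
          refine (norm_sum_le _ _).trans (Finset.sum_le_sum fun I _ => ?_)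
          refine (ContinuousMultilinearMap.norm_compContinuousLinearMap_le _ _).trans ?_
          rw [ContinuousMultilinearMap.norm_mkPiRing]
          refine mul_le_mul (hc n I) ?_ (Finset.prod_nonneg fun _ _ => norm_nonneg _)
            (by positivity)
          refine (Finset.prod_le_prod (fun _ _ => norm_nonneg _) (fun j _ => hK (I j))).trans ?_
          simp
      _ = C * (m * r * K) ^ n := by
          simp [m, mul_pow]; ring
  have hR : 0 < (m * r * K + 1)⁻¹ := by positivity
  have hrad : 0 < p.radius := by
    refine lt_of_lt_of_le ?_ (p.le_radius_of_bound C (r := ⟨(m * r * K + 1)⁻¹, hR.le⟩) ?_)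
    · exact ENNReal.coe_pos.2 hR
    · intro n
      refine (mul_le_mul_of_nonneg_right (hp n) (by positivity)).trans ?_
      change C * (m * r * K) ^ n * ((m * r * K + 1)⁻¹) ^ n ≤ C
      rw [mul_assoc, ← mul_pow]
      refine mul_le_of_le_one_right hC (pow_le_one₀ (by positivity) ?_)
      rw [← div_eq_mul_inv, div_le_one (by positivity)]
      linarith
  refine ⟨p.sum, (p.hasFPowerSeriesOnBall hrad).analyticAt, ?_⟩
  filter_upwards [(p.hasFPowerSeriesOnBall hrad).eventually_hasSum] with w hw
  simpa [p, sum_apply] using hw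

open Filter Topology in
/-- Expansion of the power series of an analytic function in coordinates. -/
theorem AnalyticAt.exists_hasSum_basis {𝕜 ι E G : Type} [RCLike 𝕜] [Fintype ι]
    [NormedAddCommGroup E] [NormedSpace 𝕜 E] [NormedAddCommGroup G] [NormedSpace 𝕜 G]
    (b : Module.Basis ι 𝕜 E) {f : E → G} (hf : AnalyticAt 𝕜 f 0) :
    ∃ (c : ∀ n : ℕ, (Fin n → ι) → G) (C r : ℝ), 0 ≤ C ∧ 0 ≤ r ∧
      (∀ n I, ‖c n I‖ ≤ C * r ^ n) ∧
      ∀ᶠ z in 𝓝 (0 : E), HasSum (fun n => ∑ I, (∏ j : Fin n, b.repr z (I j)) • c n I) (f z) := by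
  classical
  obtain ⟨p, hp⟩ := hf
  obtain ⟨R, hR0, hR⟩ := ENNReal.lt_iff_exists_nnreal_btwn.1 hp.radius_pos
  have hR0' : (0 : ℝ) < R := by exact_mod_cast hR0
  obtain ⟨C, hC, hpC⟩ := p.norm_le_div_pow_of_pos_of_lt_radius (by exact_mod_cast hR0) hR
  let K : ℝ := ∑ i, ‖b i‖
  have hK : ∀ i, ‖b i‖ ≤ K := fun i =>
    Finset.single_le_sum (f := fun i => ‖b i‖) (fun _ _ => norm_nonneg _) (Finset.mem_univ i)
  have hK0 : 0 ≤ K := Finset.sum_nonneg fun _ _ => norm_nonneg _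
  refine ⟨fun n I => p n (fun j => b (I j)), C, K / R, hC.le, by positivity, ?_, ?_⟩
  · intro n I
    calc _ ≤ ‖p n‖ * ∏ j, ‖b (I j)‖ := (p n).le_opNorm _
      _ ≤ C / R ^ n * K ^ n := by
        refine mul_le_mul (hpC n) ?_ (Finset.prod_nonneg fun _ _ => norm_nonneg _)
            (by positivity)
        refine (Finset.prod_le_prod (fun _ _ => norm_nonneg _) (fun j _ => hK (I j))).trans ?_
        simp
      _ = _ := by rw [div_pow]; ring
  · filter_upwards [hp.eventually_hasSum] with z hz
    rw [zero_add] at hz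
    convert! hz using 2 with n
    conv_rhs => rw [← b.sum_repr z]
    rw [ContinuousMultilinearMap.map_sum]
    exact Finset.sum_congr rfl fun I _ => ((p n).map_smul_univ _ _).symm

open Filter Topology in
theorem analyticAt_conjMap {N : ℕ} {H : Cn N → Cn N} (hH : AnalyticAt ℂ H 0) :
    AnalyticAt ℂ (conjMap N H) 0 := by
  obtain ⟨c, C, r, hC, hr, hc, hs⟩ := hH.exists_hasSum_basis (Pi.basisFun ℂ (Fin N))
  obtain ⟨Q, hQ, hQs⟩ := exists_analyticAt_hasSum_prod_smul (W := Cn N)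
    (fun n I => conjV N (c n I)) hC hr
    (fun n I => by
      refine le_of_eq_of_le ?_ (hc n I)
      simp [conjV, Pi.norm_def])
    (fun i => ContinuousLinearMap.proj i)
  refine hQ.congr ?_
  have hcont : Continuous (conjV N) := by unfold conjV; fun_prop
  have h0 : conjV N 0 = 0 := by ext; simp [conjV]
  have hs' := (hcont.tendsto' 0 0 h0).eventually hs
  filter_upwards [hQs, hs'] with w hw hw'
  refine hw.unique ?_
  rw [Pi.hasSum] at hw' ⊢
  intro i
  have := Complex.hasSum_conj'.2 (hw' i)
  simpa [conjV, conjMap] using this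

open Filter Topology in
/-- Existence of complexifications. -/
theorem exists_complexification {N : ℕ} {G : Type} [NormedAddCommGroup G] [NormedSpace ℂ G]
    [CompleteSpace G] {f : Cn N → G} (hf : AnalyticAt ℝ f 0) :
    ∃ Q : Cn N × Cn N → G, AnalyticAt ℂ Q (0, 0) ∧ ∀ᶠ z in 𝓝 (0 : Cn N), Q (z, conjV N z) = f z := by
  let b : Module.Basis (Σ _ : Fin N, Fin 2) ℝ (Cn N) := Pi.basis fun _ => Complex.basisOneI
  obtain ⟨c, C, r, hC, hr, hc, hs⟩ := hf.exists_hasSum_basis b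
  let x (i : Fin N) : Cn N × Cn N →L[ℂ] ℂ :=
    (ContinuousLinearMap.proj i).comp (ContinuousLinearMap.fst ℂ (Cn N) (Cn N))
  let y (i : Fin N) : Cn N × Cn N →L[ℂ] ℂ :=
    (ContinuousLinearMap.proj i).comp (ContinuousLinearMap.snd ℂ (Cn N) (Cn N))
  let l : (Σ _ : Fin N, Fin 2) → Cn N × Cn N →L[ℂ] ℂ := fun i =>
    if i.2 = 0 then (1 / 2 : ℂ) • (x i.1 + y i.1) else (1 / (2 * I) : ℂ) • (x i.1 - y i.1)
  have hl : ∀ i z, l i (z, conjV N z) = ((b.repr z i : ℝ) : ℂ) := by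
    rintro ⟨i, j⟩ z
    fin_cases j
    · simp [l, x, y, b, conjV, Complex.re_eq_add_conj]
      ring
    · simp [l, x, y, b, conjV, Complex.im_eq_sub_conj]
      field_simp
      rw [Complex.I_sq]
      ring
  obtain ⟨Q, hQ, hQs⟩ := exists_analyticAt_hasSum_prod_smul c hC hr hc l
  refine ⟨Q, hQ, ?_⟩
  have hcont : Continuous fun z => (z, conjV N z) := by unfold conjV; fun_prop
  have h0 : ((0 : Cn N), conjV N 0) = 0 := by ext <;> simp [conjV]
  have hQs' := (hcont.tendsto' 0 0 h0).eventually hQs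
  filter_upwards [hQs', hs] with z hz hz'
  refine hz.unique ?_
  simpa only [hl, ← Complex.ofReal_prod, Complex.coe_smul] using hz'

theorem AnalyticAt.continuousLinearMap_apply {𝕜 E F G : Type} [RCLike 𝕜]
    [NormedAddCommGroup E] [NormedSpace 𝕜 E] [NormedAddCommGroup F] [NormedSpace 𝕜 F]
    [NormedAddCommGroup G] [NormedSpace 𝕜 G] {f : E → F →L[𝕜] G} {g : E → F} {x : E}
    (hf : AnalyticAt 𝕜 f x) (hg : AnalyticAt 𝕜 g x) : AnalyticAt 𝕜 (fun w => f w (g w)) x :=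
  AnalyticAt.comp (f := fun w => (f w, g w))
    ((ContinuousLinearMap.id 𝕜 (F →L[𝕜] G)).analyticAt_bilinear (f x, g x)) (hf.prod hg)

open Filter Topology Asymptotics in
/-- The low order homogeneous terms of an analytic function vanishing to order `k` vanish. -/
theorem HasFPowerSeriesAt.apply_eq_zero_of_isBigO {𝕜 E G : Type} [RCLike 𝕜]
    [NormedAddCommGroup E] [NormedSpace 𝕜 E] [NormedAddCommGroup G] [NormedSpace 𝕜 G]
    {f : E → G} {p : FormalMultilinearSeries 𝕜 E G} (hp : HasFPowerSeriesAt f p 0) {k : ℕ}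
    (h : f =O[𝓝 0] fun z => ‖z‖ ^ k) {n : ℕ} (hn : n < k) (z : E) : p n (fun _ => z) = 0 := by
  induction n using Nat.strong_induction_on generalizing z with
  | _ n ih =>
    have h1 := hp.isBigO_sub_partialSum_pow (n + 1)
    simp only [zero_add] at h1
    have h2 : f =O[𝓝 0] fun z => ‖z‖ ^ (n + 1) := by
      refine h.trans (IsBigO.of_bound 1 ?_)
      filter_upwards [Metric.ball_mem_nhds (0 : E) one_pos] with y hy
      simp only [norm_pow, norm_norm, one_mul]
      exact pow_le_pow_of_le_one (norm_nonneg _) (by simpa using (mem_ball_zero_iff.1 hy).le) hn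
    have h3 := h2.sub h1
    refine IsBigO.continuousMultilinearMap_apply_eq_zero (p := p n) ?_ z
    refine h3.congr_left fun y => ?_
    rw [FormalMultilinearSeries.partialSum, Finset.sum_range_succ,
      Finset.sum_eq_zero fun m hm => ih m (Finset.mem_range.1 hm)
        ((Finset.mem_range.1 hm).trans hn) y]
    simp

open Filter Topology Asymptotics in
/-- A holomorphic function vanishing to order `k` along `ζ = Z̄` vanishes to order `k`. -/
theorem isBigO_of_isBigO_conj {N k : ℕ} {G : Type} [NormedAddCommGroup G] [NormedSpace ℂ G]
    {R : Cn N × Cn N → G} (hR : AnalyticAt ℂ R (0, 0))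
    (h : (fun z => R (z, conjV N z)) =O[𝓝 (0 : Cn N)] fun z => ‖z‖ ^ k) :
    R =O[𝓝 0] fun w => ‖w‖ ^ k := by
  obtain ⟨p, hp⟩ := hR
  let c : Cn N →ₗ[ℝ] Cn N :=
    { toFun := conjV N
      map_add' := fun a b => by ext; simp [conjV]
      map_smul' := fun a b => by ext; simp [conjV] }
  let i : Cn N →L[ℝ] Cn N × Cn N := (LinearMap.prod LinearMap.id c).toContinuousLinearMap
  have hi : ∀ z, i z = (z, conjV N z) := fun z => rfl
  have hpi : HasFPowerSeriesAt (R ∘ i)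
      ((p.restrictScalars ℝ).compContinuousLinearMap i) 0 := by
    apply HasFPowerSeriesAt.compContinuousLinearMap
    rw [map_zero]
    exact hp.restrictScalars
  have hz : ∀ n < k, ∀ z, p n (fun _ => i z) = 0 := fun n hn z =>
    hpi.apply_eq_zero_of_isBigO h hn z
  have hw : ∀ n < k, ∀ w, p n (fun _ => w) = 0 := by
    intro n hn w
    let u : Cn N := fun j => (w.1 j + (starRingEnd ℂ) (w.2 j)) / 2
    let v : Cn N := fun j => (w.1 j - (starRingEnd ℂ) (w.2 j)) / (2 * I)
    have huv : i u + I • i v = w := by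
      rw [hi, hi]
      ext j
      · simp only [u, v, Prod.fst_add, Prod.smul_fst, Pi.add_apply, Pi.smul_apply, smul_eq_mul]
        field_simp
        ring
      · simp only [u, v, conjV, Prod.snd_add, Prod.smul_snd, Pi.add_apply, Pi.smul_apply,
          smul_eq_mul, map_div₀, map_add, map_sub, map_mul, Complex.conj_conj, Complex.conj_I,
          map_ofNat]
        field_simp
        ring
    let g : ℂ → G := fun s => p n (fun _ => i u + s • i v)
    have hg : AnalyticOnNhd ℂ g Set.univ := by
      intro s _
      refine (p n).analyticAt.comp (f := fun s : ℂ => fun _ : Fin n => i u + s • i v) ?_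
      rw [analyticAt_pi_iff]
      intro _
      fun_prop
    have hg0 : ∃ᶠ s in 𝓝[≠] (0 : ℂ), g s = 0 := by
      have ht : Tendsto (fun t : ℝ => (t : ℂ)) (𝓝[≠] 0) (𝓝[≠] 0) := by
        refine tendsto_nhdsWithin_iff.2 ⟨?_, ?_⟩
        · exact (Complex.continuous_ofReal.tendsto' 0 0 (by simp)).mono_left nhdsWithin_le_nhds
        · filter_upwards [self_mem_nhdsWithin] with t ht
          simpa using ht
      refine ht.frequently (Eventually.frequently (Eventually.of_forall fun t => ?_))
      have := hz n hn (u + t • v)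
      simpa [g, Complex.coe_smul] using this
    have := hg.eqOn_zero_of_preconnected_of_frequently_eq_zero isPreconnected_univ
      (Set.mem_univ 0) hg0 (Set.mem_univ I)
    simpa [g, huv] using this
  have h1 := hp.isBigO_sub_partialSum_pow k
  refine h1.congr_left fun w => ?_
  rw [FormalMultilinearSeries.partialSum, Finset.sum_eq_zero fun n hn =>
    hw n (Finset.mem_range.1 hn) w, sub_zero, Prod.mk_zero_zero, zero_add]

/-- Division of a homogeneous polynomial difference. -/
theorem ContinuousMultilinearMap.exists_analytic_sub_eq {𝕜 W : Type} [RCLike 𝕜]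
    [NormedAddCommGroup W] [NormedSpace 𝕜 W] (π : W →L[𝕜] W) (n : ℕ) :
    ∀ {G : Type} [NormedAddCommGroup G] [NormedSpace 𝕜 G]
      (p : ContinuousMultilinearMap 𝕜 (fun _ : Fin n => W) G),
      ∃ B : W → W →L[𝕜] G, (∀ w, AnalyticAt 𝕜 B w) ∧
        ∀ w, p (fun _ => w) - p (fun _ => π w) = B w (w - π w) := by
  induction n with
  | zero =>
    intro G _ _ p
    exact ⟨fun _ => 0, fun _ => analyticAt_const, fun w => by
      simp [Subsingleton.elim (fun _ : Fin 0 => w) (fun _ => π w)]⟩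
  | succ n ih =>
    intro G _ _ p
    obtain ⟨B, hB, hB'⟩ := ih p.curryRight
    refine ⟨fun w => p.curryRight (fun _ => π w) + (B w).flip w, fun w => ?_, fun w => ?_⟩
    · refine AnalyticAt.add ?_ ?_
      · refine p.curryRight.analyticAt.comp (f := fun w => fun _ : Fin n => π w) ?_
        rw [analyticAt_pi_iff]
        intro _
        exact π.analyticAt w
      · have : AnalyticAt 𝕜 (fun T : W →L[𝕜] W →L[𝕜] G => T.flip) (B w) :=
          LinearIsometryEquiv.analyticAt (𝕜 := 𝕜) (E := W →L[𝕜] W →L[𝕜] G)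
            (F := W →L[𝕜] W →L[𝕜] G) (ContinuousLinearMap.flipₗᵢ 𝕜 W W G) (B w)
        exact AnalyticAt.continuousLinearMap_apply (this.comp (hB w)) analyticAt_id
    · have hp : ∀ w, p (fun _ => w) = p.curryRight (fun _ => w) w := by
        intro w
        rw [ContinuousMultilinearMap.curryRight_apply]
        congr 1
        ext j
        refine Fin.lastCases ?_ (fun j => ?_) j <;> simp
      rw [hp, hp]
      have := congrArg (fun T : W →L[𝕜] G => T w) (hB' w)
      simp only [sub_apply] at this
      simp only [add_apply, ContinuousLinearMap.flip_apply]
      rw [← this, map_sub]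
      abel

open Filter Topology Asymptotics in
/-- Hadamard-type division, up to an error of order `k`. -/
theorem AnalyticAt.exists_sub_isBigO {𝕜 W G : Type} [RCLike 𝕜]
    [NormedAddCommGroup W] [NormedSpace 𝕜 W] [NormedAddCommGroup G] [NormedSpace 𝕜 G]
    {g : W → G} (hg : AnalyticAt 𝕜 g 0) (π : W →L[𝕜] W) (k : ℕ) :
    ∃ A : W → W →L[𝕜] G, AnalyticAt 𝕜 A 0 ∧
      (fun w => g w - g (π w) - A w (w - π w)) =O[𝓝 0] fun w => ‖w‖ ^ k := by
  obtain ⟨p, hp⟩ := hg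
  choose B hB hB' using fun n => (p n).exists_analytic_sub_eq π n
  refine ⟨fun w => ∑ n ∈ Finset.range k, B n w,
    Finset.analyticAt_fun_sum _ fun n _ => hB n 0, ?_⟩
  have h1 := hp.isBigO_sub_partialSum_pow k
  simp only [zero_add] at h1
  have h2 : (fun w => g (π w) - p.partialSum k (π w)) =O[𝓝 0] fun w => ‖w‖ ^ k := by
    have h3 := h1.comp_tendsto (π.continuous.tendsto' 0 0 π.map_zero)
    refine h3.trans ?_
    exact ((π.isBigO_id (𝓝 0)).norm_norm).pow k
  refine (h1.sub h2).congr_left fun w => ?_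
  simp only [FormalMultilinearSeries.partialSum, sum_apply, ← hB',
    Finset.sum_sub_distrib]
  abel

open Filter Topology Asymptotics in
/-- Vanishing to order `k` at the origin in terms of explicit constants. -/
theorem isBigO_norm_pow_iff {E G : Type} [NormedAddCommGroup E] [NormedAddCommGroup G]
    {g : E → G} {k : ℕ} :
    (g =O[𝓝 0] fun x => ‖x‖ ^ k) ↔
      ∃ C ε : ℝ, 0 < ε ∧ ∀ x : E, ‖x‖ < ε → ‖g x‖ ≤ C * ‖x‖ ^ k := by
  rw [isBigO_iff]
  refine exists_congr fun C => ?_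
  rw [Metric.eventually_nhds_iff]
  simp

open Filter Topology Asymptotics in
theorem isBigO_norm_pow_prod_iff {E F G : Type} [NormedAddCommGroup E] [NormedAddCommGroup F]
    [NormedAddCommGroup G] {g : E × F → G} {k : ℕ} :
    (g =O[𝓝 0] fun x => ‖x‖ ^ k) ↔
      ∃ C ε : ℝ, 0 < ε ∧ ∀ x y, ‖x‖ < ε → ‖y‖ < ε → ‖g (x, y)‖ ≤ C * max ‖x‖ ‖y‖ ^ k := by
  rw [isBigO_norm_pow_iff]
  simp [Prod.forall, Prod.norm_def]

open Filter Topology in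
/-- A linear map `L` completing `ρ` to local coordinates at the origin, with inverse `Ψ`. -/
structure IsStraightening {N d : ℕ} (ρ : Cn N → Rn d) (L : Cn N →L[ℝ] Rn (2 * N - d))
    (Ψ : Rn d × Rn (2 * N - d) → Cn N) : Prop where
  analyticAt : AnalyticAt ℝ Ψ 0
  map_zero : Ψ 0 = 0
  left_inv : ∀ᶠ z in 𝓝 0, Ψ (ρ z, L z) = z
  right_inv : ∀ᶠ w in 𝓝 0, (ρ (Ψ w), L (Ψ w)) = w
  eq_zero : ∀ v, fderiv ℝ ρ 0 v = 0 → L v = 0 → v = 0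

theorem finrank_Cn (N : ℕ) : Module.finrank ℝ (Cn N) = 2 * N := by
  simp [Cn, Module.finrank_pi_fintype, Complex.finrank_real_complex, mul_comm]

open Filter Topology in
theorem exists_isStraightening {N d : ℕ} {ρ : Cn N → Rn d} (hρ : AnalyticAt ℝ ρ 0)
    (hρ0 : ρ 0 = 0) (hs : Function.Surjective (fderiv ℝ ρ 0)) :
    ∃ L Ψ, IsStraightening ρ L Ψ := by
  set T := fderiv ℝ ρ 0 with hT
  have hr := T.toLinearMap.finrank_range_add_finrank_ker
  rw [LinearMap.range_eq_top.2 hs, finrank_top, finrank_Cn, Module.finrank_fin_fun] at hr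
  have hk : Module.finrank ℝ T.toLinearMap.ker = Module.finrank ℝ (Rn (2 * N - d)) := by
    rw [Module.finrank_fin_fun]; omega
  let e := LinearEquiv.ofFinrankEq _ _ hk
  obtain ⟨g, hg⟩ := T.toLinearMap.ker.subtype.exists_leftInverse_of_injective
    (Submodule.ker_subtype _)
  let L : Cn N →L[ℝ] Rn (2 * N - d) := (e.toLinearMap ∘ₗ g).toContinuousLinearMap
  have hL : ∀ v, T v = 0 → L v = 0 → v = 0 := by
    intro v hv hv'
    have h1 : g v = ⟨v, hv⟩ := congrArg (fun f => f ⟨v, hv⟩) hg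
    have h2 : e (g v) = 0 := hv'
    rw [e.map_eq_zero_iff, h1] at h2
    exact congrArg Subtype.val h2
  have hd : HasFDerivAt (fun z => (ρ z, L z)) (T.prod L) 0 :=
    hρ.differentiableAt.hasFDerivAt.prodMk L.hasFDerivAt
  have hinj : Function.Injective (T.prod L) := by
    refine (injective_iff_map_eq_zero _).2 fun v hv => ?_
    rw [ContinuousLinearMap.prod_apply, Prod.mk_eq_zero] at hv
    exact hL v hv.1 hv.2
  have hb : Function.Bijective (fderiv ℝ (fun z => (ρ z, L z)) 0) := by
    rw [hd.fderiv]
    refine ⟨hinj, (LinearMap.injective_iff_surjective_of_finrank_eq_finrank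
      (f := (T.prod L).toLinearMap) ?_).1 hinj⟩
    rw [finrank_Cn, Module.finrank_prod, Module.finrank_fin_fun, Module.finrank_fin_fun]
    omega
  obtain ⟨Ψ, h1, h2, h3, h4⟩ := (hρ.prod (L.analyticAt 0)).exists_local_inverse hb
  have h0 : ((ρ 0, L 0) : Rn d × Rn (2 * N - d)) = 0 := by simp [hρ0]
  rw [h0] at h1 h2 h4
  exact ⟨L, Ψ, h1, h2, h3, h4, hL⟩

namespace IsDefiningFun

open Filter Topology

variable {N d : ℕ} {M : Set (Cn N)} {U : Set (Cn N)} {ρ : Cn N → Rn d}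

theorem analyticAt (h : IsDefiningFun N d M 0 U ρ) : AnalyticAt ℝ ρ 0 := h.2.2.1 0 h.2.1

theorem eventually_mem_iff (h : IsDefiningFun N d M 0 U ρ) : ∀ᶠ z in 𝓝 0, (z ∈ M ↔ ρ z = 0) := by
  filter_upwards [h.1.mem_nhds h.2.1] with z hz using h.2.2.2.1 z hz

theorem map_zero (h : IsDefiningFun N d M 0 U ρ) (h0 : 0 ∈ M) : ρ 0 = 0 :=
  (h.2.2.2.1 0 h.2.1).1 h0

theorem surjective (h : IsDefiningFun N d M 0 U ρ) : Function.Surjective (fderiv ℝ ρ 0) :=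
  h.2.2.2.2 0 h.2.1

theorem exists_isStraightening (h : IsDefiningFun N d M 0 U ρ) (h0 : 0 ∈ M) :
    ∃ L Ψ, IsStraightening ρ L Ψ :=
  _root_.exists_isStraightening h.analyticAt (h.map_zero h0) h.surjective

end IsDefiningFun

open Filter Topology in
/-- Germs at the origin of defining functions. -/
theorem exists_isDefiningFun {N d : ℕ} {M : Set (Cn N)} {σ : Cn N → Rn d}
    (hσ : AnalyticAt ℝ σ 0) (hs : Function.Surjective (fderiv ℝ σ 0))
    (hM : ∀ᶠ z in 𝓝 0, (z ∈ M ↔ σ z = 0)) : ∃ U, IsDefiningFun N d M 0 U σ := by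
  obtain ⟨S, hS⟩ := (fderiv ℝ σ 0).toLinearMap.exists_rightInverse_of_surjective
    (LinearMap.range_eq_top.2 hs)
  let S' : Rn d →L[ℝ] Cn N := S.toContinuousLinearMap
  have hc : ContinuousAt (fun z => (fderiv ℝ σ z).comp S') 0 :=
    hσ.fderiv.continuousAt.clm_comp continuousAt_const
  have h1 : (fderiv ℝ σ 0).comp S' = 1 := by
    ext v : 1
    exact congrArg (fun f => f v) hS
  have hu : ∀ᶠ z in 𝓝 0, IsUnit ((fderiv ℝ σ z).comp S') := by
    refine hc.eventually (p := fun T => IsUnit T) ?_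
    simp only [h1]
    exact Units.isOpen.mem_nhds isUnit_one
  have hsu : ∀ᶠ z in 𝓝 0, Function.Surjective (fderiv ℝ σ z) := by
    filter_upwards [hu] with z hz y
    obtain ⟨T, hT⟩ := hz
    refine ⟨S' ((T⁻¹ : (Rn d →L[ℝ] Rn d)ˣ).val y), ?_⟩
    have : T.val * (T⁻¹).val = 1 := T.mul_inv
    rw [hT] at this
    exact congrArg (fun f => f y) this
  obtain ⟨U, hU, hUo, h0⟩ := eventually_nhds_iff.1
    (hM.and (hsu.and hσ.eventually_analyticAt))
  exact ⟨U, hUo, h0, fun z hz => (hU z hz).2.2, fun z hz => (hU z hz).1,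
    fun z hz => (hU z hz).2.1⟩

open Filter Topology in
/-- An analytic germ with an analytic left inverse which is an inverse on `M` defines a local
parametrization. -/
theorem exists_isLocalParam {N d : ℕ} {M : Set (Cn N)} {Z : Rn (2 * N - d) → Cn N}
    {κ : Cn N → Rn (2 * N - d)} (hZ : AnalyticAt ℝ Z 0) (hZ0 : Z 0 = 0)
    (hκ : AnalyticAt ℝ κ 0) (hκ0 : κ 0 = 0) (h1 : ∀ᶠ x in 𝓝 0, κ (Z x) = x)
    (h2 : ∀ᶠ x in 𝓝 0, Z x ∈ M) (h3 : ∀ᶠ z in 𝓝 0, z ∈ M → Z (κ z) = z) :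
    ∃ Ω, IsLocalParam N d M 0 Ω Z := by
  obtain ⟨B, hB, hBo, hB0⟩ := eventually_nhds_iff.1
    (h1.and (h2.and (hZ.eventually_analyticAt)))
  have hκB : ∀ᶠ z in 𝓝 0, κ z ∈ B :=
    hκ.continuousAt.eventually (by rw [hκ0]; exact hBo.mem_nhds hB0)
  obtain ⟨V, hV, hVo, hV0⟩ := eventually_nhds_iff.1
    (hκB.and (h3.and (hκ.eventually_analyticAt)))
  have hcont : ContinuousOn Z B := fun x hx => (hB x hx).2.2.continuousAt.continuousWithinAt
  refine ⟨B ∩ Z ⁻¹' V, hcont.isOpen_inter_preimage hBo hVo, ⟨hB0, ?_⟩, hZ0,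
    fun x hx => (hB x hx.1).2.2, ?_, ?_, V, hVo, hV0, ?_⟩
  · rwa [Set.mem_preimage, hZ0]
  · intro x hx y hy hxy
    rw [← (hB x hx.1).1, hxy, (hB y hy.1).1]
  · intro x hx
    have hid : (κ ∘ Z) =ᶠ[𝓝 x] id := by
      filter_upwards [hBo.mem_nhds hx.1] with y hy using (hB y hy).1
    have hd := (hV (Z x) hx.2).2.2.differentiableAt.hasFDerivAt.comp x
      (hB x hx.1).2.2.differentiableAt.hasFDerivAt
    have h4 := hd.unique ((hasFDerivAt_id x).congr_of_eventuallyEq hid)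
    refine Function.LeftInverse.injective (g := fderiv ℝ κ (Z x)) fun v => ?_
    exact congrArg (fun f => f v) h4
  · ext z
    constructor
    · rintro ⟨x, hx, rfl⟩
      exact ⟨(hB x hx.1).2.1, hx.2⟩
    · rintro ⟨hzM, hzV⟩
      have hz := (hV z hzV).2.1 hzM
      exact ⟨κ z, ⟨(hV z hzV).1, by rwa [Set.mem_preimage, hz]⟩, hz⟩

namespace IsStraightening

open Filter Topology Asymptotics

variable {N d k : ℕ} {ρ : Cn N → Rn d} {L : Cn N →L[ℝ] Rn (2 * N - d)}
  {Ψ : Rn d × Rn (2 * N - d) → Cn N}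

theorem tendsto_mk (hρ : AnalyticAt ℝ ρ 0) (hρ0 : ρ 0 = 0) :
    Tendsto (fun z => (ρ z, L z)) (𝓝 0) (𝓝 0) := by
  have : ContinuousAt (fun z => (ρ z, L z)) 0 :=
    hρ.continuousAt.prodMk L.continuous.continuousAt
  rw [ContinuousAt, hρ0, _root_.map_zero] at this
  exact this

/-- A germ of an immersion that is tangent to `ρ = 0` projects to a local diffeomorphism. -/
theorem exists_inverse (h : IsStraightening ρ L Ψ) (hρ : AnalyticAt ℝ ρ 0) (hk : 1 < k)
    {γ : Rn (2 * N - d) → Cn N} (hγ : AnalyticAt ℝ γ 0) (hγ0 : γ 0 = 0)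
    (hi : Function.Injective (fderiv ℝ γ 0))
    (hO : (fun x => ρ (γ x)) =O[𝓝 0] fun x => ‖x‖ ^ k) :
    ∃ η : Rn (2 * N - d) → Rn (2 * N - d), AnalyticAt ℝ η 0 ∧ η 0 = 0 ∧
      (∀ᶠ x in 𝓝 0, η (L (γ x)) = x) ∧ ∀ᶠ t in 𝓝 0, L (γ (η t)) = t := by
  have hγd := hγ.differentiableAt.hasFDerivAt
  have h1 : HasFDerivAt (fun x => ρ (γ x)) ((fderiv ℝ ρ 0).comp (fderiv ℝ γ 0)) 0 := by
    refine HasFDerivAt.comp 0 ?_ hγd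
    rw [hγ0]
    exact hρ.differentiableAt.hasFDerivAt
  have h2 : HasFDerivAt (fun x => ρ (γ x)) (0 : Rn (2 * N - d) →L[ℝ] Rn d) 0 :=
    IsBigO.hasFDerivAt (by simpa using hO) hk
  have h3 := h1.unique h2
  have hd : HasFDerivAt (fun x => L (γ x)) (L.comp (fderiv ℝ γ 0)) 0 :=
    L.hasFDerivAt.comp 0 hγd
  have hinj : Function.Injective (L.comp (fderiv ℝ γ 0)) := by
    refine (injective_iff_map_eq_zero _).2 fun v hv => ?_
    refine (injective_iff_map_eq_zero _).1 hi v (h.eq_zero _ ?_ hv)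
    exact congrArg (fun f => f v) h3
  have hb : Function.Bijective (fderiv ℝ (fun x => L (γ x)) 0) := by
    rw [hd.fderiv]
    exact ⟨hinj, (LinearMap.injective_iff_surjective
      (f := (L.comp (fderiv ℝ γ 0)).toLinearMap)).1 hinj⟩
  have hA : AnalyticAt ℝ (fun x => L (γ x)) 0 := (L.analyticAt _).comp hγ
  obtain ⟨η, e1, e2, e3, e4⟩ := hA.exists_local_inverse hb
  have h0 : L (γ 0) = 0 := by rw [hγ0, _root_.map_zero]
  rw [h0] at e1 e2 e4
  exact ⟨η, e1, e2, e3, e4⟩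

/-- Division of an analytic germ vanishing to order `k` on `M` by a defining function of `M`. -/
theorem exists_division (h : IsStraightening ρ L Ψ) (hρ : AnalyticAt ℝ ρ 0) (hρ0 : ρ 0 = 0)
    {M : Set (Cn N)} (hM : ∀ᶠ z in 𝓝 0, (z ∈ M ↔ ρ z = 0))
    {G : Type} [NormedAddCommGroup G] [NormedSpace ℝ G] {f : Cn N → G}
    (hf : AnalyticAt ℝ f 0) (hO : f =O[𝓝[M] 0] fun z => ‖z‖ ^ k) :
    ∃ a : Cn N → Rn d →L[ℝ] G, AnalyticAt ℝ a 0 ∧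
      (fun z => f z - a z (ρ z)) =O[𝓝 0] fun z => ‖z‖ ^ k := by
  have hΨt : Tendsto Ψ (𝓝 0) (𝓝 0) := by
    simpa [ContinuousAt, h.map_zero] using h.analyticAt.continuousAt
  have hg : AnalyticAt ℝ (fun w => f (Ψ w)) 0 :=
    AnalyticAt.comp (by rwa [h.map_zero]) h.analyticAt
  let π : Rn d × Rn (2 * N - d) →L[ℝ] Rn d × Rn (2 * N - d) :=
    (ContinuousLinearMap.inr ℝ _ _).comp (ContinuousLinearMap.snd ℝ _ _)
  have hπ : ∀ w, π w = (0, w.2) := fun w => rfl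
  have hπt : Tendsto π (𝓝 0) (𝓝 0) := π.continuous.tendsto' 0 0 (ContinuousLinearMap.map_zero π)
  obtain ⟨A, hA, hAO⟩ := hg.exists_sub_isBigO π k
  have hΨO : Ψ =O[𝓝 0] fun w => w := by
    simpa [h.map_zero] using h.analyticAt.differentiableAt.isBigO_sub
  have hmem : ∀ᶠ w in 𝓝 0, Ψ (π w) ∈ M := by
    filter_upwards [hπt.eventually h.right_inv, (hΨt.comp hπt).eventually hM] with w hw hw'
    exact hw'.2 (congrArg Prod.fst hw)
  have hgπ : (fun w => f (Ψ (π w))) =O[𝓝 0] fun w => ‖w‖ ^ k := by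
    have ht : Tendsto (fun w => Ψ (π w)) (𝓝 0) (𝓝[M] 0) :=
      tendsto_nhdsWithin_iff.2 ⟨hΨt.comp hπt, hmem⟩
    refine (hO.comp_tendsto ht).trans (IsBigO.pow (IsBigO.norm_norm ?_) k)
    exact (hΨO.comp_tendsto hπt).trans (π.isBigO_id _)
  have hall : (fun w => f (Ψ w) - A w (w - π w)) =O[𝓝 0] fun w => ‖w‖ ^ k := by
    refine (hAO.add hgπ).congr_left fun w => ?_
    abel
  let ι : Rn d →L[ℝ] Rn d × Rn (2 * N - d) := ContinuousLinearMap.inl ℝ _ _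
  have ht := tendsto_mk (L := L) hρ hρ0
  have hAn : AnalyticAt ℝ (fun z => (ρ z, L z)) 0 := hρ.prod (L.analyticAt 0)
  have h00 : (ρ 0, L 0) = 0 := by simp [hρ0]
  refine ⟨fun z => (A (ρ z, L z)).comp ι, ?_, ?_⟩
  · have : AnalyticAt ℝ (fun z => A (ρ z, L z)) 0 :=
      AnalyticAt.comp (g := A) (f := fun z => (ρ z, L z)) (by rwa [h00]) hAn
    exact ((ContinuousLinearMap.compL ℝ _ _ G).flip ι).analyticAt _ |>.comp this
  · have hmkO : (fun z => (ρ z, L z)) =O[𝓝 0] fun z => z := by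
      simpa [h00, hρ0] using hAn.differentiableAt.isBigO_sub
    refine ((hall.comp_tendsto ht).trans (IsBigO.pow hmkO.norm_norm k)).congr' ?_ .rfl
    filter_upwards [h.left_inv] with z hz
    change f (Ψ (ρ z, L z)) - A (ρ z, L z) ((ρ z, L z) - π (ρ z, L z)) =
      f z - A (ρ z, L z) (ρ z, 0)
    rw [hz, hπ]
    simp

end IsStraightening

open Filter Topology Asymptotics in
theorem AnalyticAt.tendsto_nhds_zero {𝕜 E F : Type} [NontriviallyNormedField 𝕜]
    [NormedAddCommGroup E] [NormedSpace 𝕜 E] [NormedAddCommGroup F] [NormedSpace 𝕜 F]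
    {f : E → F} (hf : AnalyticAt 𝕜 f 0) (h0 : f 0 = 0) : Tendsto f (𝓝 0) (𝓝 0) := by
  simpa [ContinuousAt, h0] using hf.continuousAt

open Filter Topology Asymptotics in
theorem AnalyticAt.isBigO_id_nhds_zero {𝕜 E F : Type} [NontriviallyNormedField 𝕜]
    [NormedAddCommGroup E] [NormedSpace 𝕜 E] [NormedAddCommGroup F] [NormedSpace 𝕜 F]
    {f : E → F} (hf : AnalyticAt 𝕜 f 0) (h0 : f 0 = 0) : f =O[𝓝 0] fun x => x := by
  simpa [h0] using hf.differentiableAt.isBigO_sub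

open Filter Topology Asymptotics in
/-- Composing a germ vanishing to order `k` on `M'` with an analytic germ into `M'`. -/
theorem Asymptotics.IsBigO.comp_norm_pow {E F G : Type} [NormedAddCommGroup E]
    [NormedSpace ℝ E] [NormedAddCommGroup F] [NormedSpace ℝ F] [NormedAddCommGroup G]
    {f : F → G} {γ : E → F} {M : Set E} {M' : Set F} {k : ℕ}
    (hf : f =O[𝓝[M'] 0] fun z => ‖z‖ ^ k)
    (hγ : AnalyticAt ℝ γ 0) (h0 : γ 0 = 0) (hmem : ∀ᶠ x in 𝓝[M] 0, γ x ∈ M') :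
    (fun x => f (γ x)) =O[𝓝[M] 0] fun x => ‖x‖ ^ k := by
  have ht : Tendsto γ (𝓝[M] 0) (𝓝[M'] 0) :=
    tendsto_nhdsWithin_iff.2 ⟨(hγ.tendsto_nhds_zero h0).mono_left nhdsWithin_le_nhds, hmem⟩
  exact (hf.comp_tendsto ht).trans
    (((hγ.isBigO_id_nhds_zero h0).mono nhdsWithin_le_nhds).norm_norm.pow k)

namespace IsLocalParam

open Filter Topology Asymptotics

variable {N d k : ℕ} {M U : Set (Cn N)} {ρ : Cn N → Rn d} {Ω : Set (Rn (2 * N - d))}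
  {Z : Rn (2 * N - d) → Cn N}

theorem analyticAt (h : IsLocalParam N d M 0 Ω Z) : AnalyticAt ℝ Z 0 := h.2.2.2.1 0 h.2.1

theorem map_zero (h : IsLocalParam N d M 0 Ω Z) : Z 0 = 0 := h.2.2.1

theorem injective (h : IsLocalParam N d M 0 Ω Z) : Function.Injective (fderiv ℝ Z 0) :=
  h.2.2.2.2.2.1 0 h.2.1

theorem eventually_mem (h : IsLocalParam N d M 0 Ω Z) : ∀ᶠ x in 𝓝 0, Z x ∈ M := by
  filter_upwards [h.1.mem_nhds h.2.1] with x hx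
  obtain ⟨V, -, -, hV⟩ := h.2.2.2.2.2.2
  exact (hV.subset (Set.mem_image_of_mem Z hx)).1

theorem isBigO_comp {G : Type} [NormedAddCommGroup G] {f : Cn N → G}
    (h : IsLocalParam N d M 0 Ω Z) (hf : f =O[𝓝[M] 0] fun z => ‖z‖ ^ k) :
    (fun x => f (Z x)) =O[𝓝 0] fun x => ‖x‖ ^ k := by
  rw [← nhdsWithin_univ]
  exact hf.comp_norm_pow h.analyticAt h.map_zero (nhdsWithin_univ (0 : Rn (2 * N - d)) ▸
    h.eventually_mem)

theorem exists_leftInverse (h : IsLocalParam N d M 0 Ω Z) (hρ : IsDefiningFun N d M 0 U ρ)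
    (h0 : 0 ∈ M) :
    ∃ κ : Cn N → Rn (2 * N - d), AnalyticAt ℝ κ 0 ∧ κ 0 = 0 ∧
      ∀ᶠ z in 𝓝 0, z ∈ M → Z (κ z) = z := by
  obtain ⟨L, Ψ, hs⟩ := hρ.exists_isStraightening h0
  have hZt := h.analyticAt.tendsto_nhds_zero h.map_zero
  have hρZ : ∀ᶠ x in 𝓝 0, ρ (Z x) = 0 := by
    filter_upwards [h.eventually_mem, hZt.eventually hρ.eventually_mem_iff] with x hx hx'
    exact hx'.1 hx
  have hO : (fun x => ρ (Z x)) =O[𝓝 0] fun x => ‖x‖ ^ 2 :=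
    (isBigO_zero _ _).congr' (hρZ.mono fun x hx => hx.symm) .rfl
  obtain ⟨η, hη, hη0, -, h2⟩ := hs.exists_inverse hρ.analyticAt one_lt_two h.analyticAt
    h.map_zero h.injective hO
  have hκ : AnalyticAt ℝ (fun z => η (L z)) 0 :=
    AnalyticAt.comp (by rwa [_root_.map_zero]) (L.analyticAt 0)
  have hκ0 : η (L 0) = 0 := by rw [_root_.map_zero, hη0]
  refine ⟨fun z => η (L z), hκ, hκ0, ?_⟩
  have hκt := hκ.tendsto_nhds_zero hκ0
  have hLt : Tendsto L (𝓝 0) (𝓝 0) := L.continuous.tendsto' 0 0 (_root_.map_zero L)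
  filter_upwards [hs.left_inv, (hZt.comp hκt).eventually hs.left_inv, hκt.eventually hρZ,
    hLt.eventually h2, hρ.eventually_mem_iff] with z h3 h4 h5 h6 h7 hz
  simp only [Function.comp_apply] at h4
  rw [← h4, h5, h6, ← h7.1 hz, h3]

end IsLocalParam

open Filter Topology Asymptotics in
theorem IsDefiningFun.exists_isLocalParam {N d : ℕ} {M U : Set (Cn N)} {ρ : Cn N → Rn d}
    (hρ : IsDefiningFun N d M 0 U ρ) (h0 : 0 ∈ M) : ∃ Ω Z, IsLocalParam N d M 0 Ω Z := by
  obtain ⟨L, Ψ, hs⟩ := hρ.exists_isStraightening h0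
  let ι : Rn (2 * N - d) →L[ℝ] Rn d × Rn (2 * N - d) := ContinuousLinearMap.inr ℝ _ _
  have hι : Tendsto ι (𝓝 0) (𝓝 0) := ι.continuous.tendsto' 0 0 (_root_.map_zero ι)
  have hZ : AnalyticAt ℝ (fun t => Ψ (ι t)) 0 :=
    AnalyticAt.comp (by rw [_root_.map_zero]; exact hs.analyticAt) (ι.analyticAt 0)
  have hZ0 : Ψ (ι 0) = 0 := by rw [_root_.map_zero, hs.map_zero]
  refine ⟨_, _, (_root_.exists_isLocalParam (M := M) hZ hZ0 (L.analyticAt 0) (_root_.map_zero L)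
    ?_ ?_ ?_).choose_spec⟩
  · filter_upwards [hι.eventually hs.right_inv] with t ht using congrArg Prod.snd ht
  · filter_upwards [hι.eventually hs.right_inv,
      (hZ.tendsto_nhds_zero hZ0).eventually hρ.eventually_mem_iff] with t ht ht'
    exact ht'.2 (congrArg Prod.fst ht)
  · filter_upwards [hs.left_inv, hρ.eventually_mem_iff] with z hz hz' hzM
    change Ψ (0, L z) = z
    rw [← hz'.1 hzM, hz]

section VanishingOrder

open Filter Topology Asymptotics

variable {N d k : ℕ} {M M' U U' : Set (Cn N)} {ρ ρ' : Cn N → Rn d} {H : Cn N → Cn N}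

theorem IsKEquivalence.isBigO (h : IsKEquivalence N d M M' 0 0 k H)
    (hρ : IsDefiningFun N d M 0 U ρ) (h0 : 0 ∈ M) (hρ' : IsDefiningFun N d M' 0 U' ρ') :
    (fun z => ρ' (H z)) =O[𝓝[M] 0] fun z => ‖z‖ ^ k := by
  obtain ⟨-, -, -, Ω, Z, hZ, hO⟩ := h
  obtain ⟨κ, hκ, hκ0, hκZ⟩ := hZ.exists_leftInverse hρ h0
  have h1 := isBigO_norm_pow_iff.2 (hO U' ρ' hρ')
  rw [← nhdsWithin_univ] at h1
  refine (h1.comp_norm_pow (M := M) hκ hκ0 (by simp)).congr' ?_ .rfl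
  rw [EventuallyEq, eventually_nhdsWithin_iff]
  filter_upwards [hκZ] with z hz hzM
  rw [hz hzM]

theorem isKEquivalence_of_isBigO (hH : AnalyticAt ℂ H 0) (hH0 : H 0 = 0)
    (hb : Function.Bijective (fderiv ℂ H 0)) (hρ : IsDefiningFun N d M 0 U ρ) (h0 : 0 ∈ M)
    (h : ∀ U' ρ', IsDefiningFun N d M' 0 U' ρ' →
      (fun z => ρ' (H z)) =O[𝓝[M] 0] fun z => ‖z‖ ^ k) :
    IsKEquivalence N d M M' 0 0 k H := by
  obtain ⟨Ω, Z, hZ⟩ := hρ.exists_isLocalParam h0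
  exact ⟨hH, hH0, hb, Ω, Z, hZ, fun U' ρ' hρ' => isBigO_norm_pow_iff.1
    (hZ.isBigO_comp (h U' ρ' hρ'))⟩

theorem IsDefiningFun.exists_division {G : Type} [NormedAddCommGroup G] [NormedSpace ℝ G]
    {f : Cn N → G} (hρ : IsDefiningFun N d M 0 U ρ) (h0 : 0 ∈ M) (hf : AnalyticAt ℝ f 0)
    (hO : f =O[𝓝[M] 0] fun z => ‖z‖ ^ k) :
    ∃ a : Cn N → Rn d →L[ℝ] G, AnalyticAt ℝ a 0 ∧
      (fun z => f z - a z (ρ z)) =O[𝓝 0] fun z => ‖z‖ ^ k := by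
  obtain ⟨L, Ψ, hs⟩ := hρ.exists_isStraightening h0
  exact hs.exists_division hρ.analyticAt (hρ.map_zero h0) hρ.eventually_mem_iff hf hO

/-- Vanishing to order `k` along `M'` pulls back under a map preserving `M'` to order `k`. -/
theorem IsDefiningFun.isBigO_comp {G : Type} [NormedAddCommGroup G] [NormedSpace ℝ G]
    {f : Cn N → G} (hρ' : IsDefiningFun N d M' 0 U' ρ') (h0' : 0 ∈ M')
    (hH : AnalyticAt ℝ H 0) (hH0 : H 0 = 0)
    (h : (fun z => ρ' (H z)) =O[𝓝[M] 0] fun z => ‖z‖ ^ k)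
    (hf : AnalyticAt ℝ f 0) (hO : f =O[𝓝[M'] 0] fun z => ‖z‖ ^ k) :
    (fun z => f (H z)) =O[𝓝[M] 0] fun z => ‖z‖ ^ k := by
  obtain ⟨a, ha, haO⟩ := hρ'.exists_division h0' hf hO
  have h1 : (fun z => f (H z) - a (H z) (ρ' (H z))) =O[𝓝[M] 0] fun z => ‖z‖ ^ k := by
    rw [← nhdsWithin_univ] at haO
    exact haO.comp_norm_pow hH hH0 (by simp)
  have hat : ContinuousAt (fun z => a (H z)) 0 :=
    ContinuousAt.comp (by rw [hH0]; exact ha.continuousAt) hH.continuousAt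
  have h2 : (fun z => a (H z) (ρ' (H z))) =O[𝓝[M] 0] fun z => ‖z‖ ^ k := by
    have hb : (fun z => a (H z)) =O[𝓝[M] 0] fun _ => (1 : ℝ) :=
      (hat.mono_left nhdsWithin_le_nhds).isBigO_one ℝ
    have h3 : (fun z => a (H z) (ρ' (H z))) =O[𝓝[M] 0] fun z => ‖a (H z)‖ * ‖ρ' (H z)‖ :=
      isBigO_of_le _ fun z => by
        rw [Real.norm_of_nonneg (by positivity)]
        exact (a (H z)).le_opNorm _
    exact h3.trans (by simpa using hb.norm_left.mul h.norm_left)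
  refine (h1.add h2).congr_left fun z => ?_
  abel

theorem IsDefiningFun.isBigO_self {U' : Set (Cn N)} (hρ' : IsDefiningFun N d M' 0 U' ρ') :
    ρ' =O[𝓝[M'] 0] fun z => ‖z‖ ^ k := by
  refine (isBigO_zero _ _).congr' ?_ .rfl
  rw [EventuallyEq, eventually_nhdsWithin_iff]
  filter_upwards [hρ'.eventually_mem_iff] with z hz hzM
  exact (hz.1 hzM).symm

end VanishingOrder

section RealFactor

open Filter Topology Asymptotics

variable {N d k : ℕ} {M M' U U' : Set (Cn N)} {ρ ρ' : Cn N → Rn d} {H : Cn N → Cn N}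
  {Ω Ω' : Set (Rn (2 * N - d))} {Z Z' : Rn (2 * N - d) → Cn N}

/-- Projecting the image of a local parametrization of `M` to `M'` along a straightening. -/
theorem IsLocalParam.exists_sub_isBigO (hZ : IsLocalParam N d M 0 Ω Z)
    (hρ' : IsDefiningFun N d M' 0 U' ρ') (h0' : 0 ∈ M') (hk : 1 < k)
    (hH : AnalyticAt ℝ H 0) (hH0 : H 0 = 0) (hi : Function.Injective (fderiv ℝ H 0))
    (h : (fun z => ρ' (H z)) =O[𝓝[M] 0] fun z => ‖z‖ ^ k) :
    ∃ Ω' Z', IsLocalParam N d M' 0 Ω' Z' ∧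
      (fun x => Z' x - H (Z x)) =O[𝓝 0] fun x => ‖x‖ ^ k := by
  obtain ⟨L, Ψ, hs⟩ := hρ'.exists_isStraightening h0'
  have hγ : AnalyticAt ℝ (fun x => H (Z x)) 0 :=
    AnalyticAt.comp (by rwa [hZ.map_zero]) hZ.analyticAt
  have hγ0 : H (Z 0) = 0 := by rw [hZ.map_zero, hH0]
  have hγi : Function.Injective (fderiv ℝ (fun x => H (Z x)) 0) := by
    have : HasFDerivAt (fun x => H (Z x)) ((fderiv ℝ H 0).comp (fderiv ℝ Z 0)) 0 := by
      refine HasFDerivAt.comp 0 ?_ hZ.analyticAt.differentiableAt.hasFDerivAt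
      rw [hZ.map_zero]
      exact hH.differentiableAt.hasFDerivAt
    rw [this.fderiv]
    exact hi.comp hZ.injective
  have hO := hZ.isBigO_comp h
  obtain ⟨η, hη, hη0, hη1, hη2⟩ := hs.exists_inverse hρ'.analyticAt hk hγ hγ0 hγi hO
  let ι : Rn (2 * N - d) →L[ℝ] Rn d × Rn (2 * N - d) := ContinuousLinearMap.inr ℝ _ _
  let p : Cn N →L[ℝ] Rn d × Rn (2 * N - d) := ι.comp L
  have hp : Tendsto p (𝓝 0) (𝓝 0) := p.continuous.tendsto' 0 0 (_root_.map_zero p)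
  have hγt := hγ.tendsto_nhds_zero hγ0
  have hΨp : AnalyticAt ℝ (fun z => Ψ (p z)) 0 :=
    AnalyticAt.comp (by rw [_root_.map_zero]; exact hs.analyticAt) (p.analyticAt 0)
  have hΨp0 : Ψ (p 0) = 0 := by rw [_root_.map_zero, hs.map_zero]
  have hZ' : AnalyticAt ℝ (fun x => Ψ (p (H (Z x)))) 0 :=
    AnalyticAt.comp (g := fun z => Ψ (p z)) (by rwa [hγ0]) hγ
  have hZ'0 : Ψ (p (H (Z 0))) = 0 := by rw [hγ0, hΨp0]
  have hκ : AnalyticAt ℝ (fun z => η (L z)) 0 :=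
    AnalyticAt.comp (by rwa [_root_.map_zero]) (L.analyticAt 0)
  have hκ0 : η (L 0) = 0 := by rw [_root_.map_zero, hη0]
  have hr : ∀ᶠ x in 𝓝 0, (ρ' (Ψ (p (H (Z x)))), L (Ψ (p (H (Z x))))) = p (H (Z x)) :=
    (hp.comp hγt).eventually hs.right_inv
  have hparam : ∃ Ω', IsLocalParam N d M' 0 Ω' fun x => Ψ (p (H (Z x))) := by
    refine exists_isLocalParam hZ' hZ'0 hκ hκ0 ?_ ?_ ?_
    · filter_upwards [hr, hη1] with x hx hx'
      exact (congrArg η (congrArg Prod.snd hx)).trans hx'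
    · filter_upwards [hr, (hZ'.tendsto_nhds_zero hZ'0).eventually hρ'.eventually_mem_iff]
        with x hx hx'
      exact hx'.2 (congrArg Prod.fst hx)
    · have hLt : Tendsto L (𝓝 0) (𝓝 0) := L.continuous.tendsto' 0 0 (_root_.map_zero L)
      filter_upwards [hs.left_inv, hρ'.eventually_mem_iff, hLt.eventually hη2] with z h1 h2 h3 hz
      change Ψ (0, L (H (Z (η (L z))))) = z
      rw [h3, ← h2.1 hz, h1]
  obtain ⟨Ω', hΩ'⟩ := hparam
  refine ⟨Ω', _, hΩ', ?_⟩
  have ht := IsStraightening.tendsto_mk (L := L) hρ'.analyticAt (hρ'.map_zero h0')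
  have hlip := hs.analyticAt.hasStrictFDerivAt.isBigO_sub
  have h1 := hlip.comp_tendsto ((hp.comp hγt).prodMk_nhds (ht.comp hγt))
  have h2 : (fun x => p (H (Z x)) - (ρ' (H (Z x)), L (H (Z x)))) =O[𝓝 0] fun x => ‖x‖ ^ k := by
    refine (hO.neg_left.prod_left (isBigO_zero (E' := Rn (2 * N - d)) _ _)).congr_left fun x => ?_
    simp [p, ι]
  refine (h1.trans h2).congr' ?_ .rfl
  filter_upwards [hγt.eventually hs.left_inv] with x hx
  simp only [Function.comp_apply, hx]

theorem IsLocalParam.isBigO_of_sub_isBigO (hZ : IsLocalParam N d M 0 Ω Z)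
    (hZ' : IsLocalParam N d M' 0 Ω' Z') (hρ' : IsDefiningFun N d M' 0 U' ρ')
    (hH : AnalyticAt ℝ H 0) (hH0 : H 0 = 0)
    (h : (fun x => Z' x - H (Z x)) =O[𝓝 0] fun x => ‖x‖ ^ k) :
    (fun x => ρ' (H (Z x))) =O[𝓝 0] fun x => ‖x‖ ^ k := by
  have hγt : Tendsto (fun x => H (Z x)) (𝓝 0) (𝓝 0) :=
    (hH.tendsto_nhds_zero hH0).comp (hZ.analyticAt.tendsto_nhds_zero hZ.map_zero)
  have hZ't := hZ'.analyticAt.tendsto_nhds_zero hZ'.map_zero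
  have h1 := (hρ'.analyticAt.hasStrictFDerivAt.isBigO_sub.comp_tendsto
    (hZ't.prodMk_nhds hγt)).trans h
  refine h1.neg_left.congr' ?_ .rfl
  filter_upwards [hZ't.eventually hρ'.eventually_mem_iff, hZ'.eventually_mem] with x hx hx'
  simp [hx.1 hx']

/-- A `k`-equivalence intertwines defining functions up to an invertible factor. -/
theorem IsDefiningFun.exists_isUnit_factor (hρ : IsDefiningFun N d M 0 U ρ) (h0 : 0 ∈ M)
    (hρ' : IsDefiningFun N d M' 0 U' ρ') (hk : 1 < k)
    (hH : AnalyticAt ℝ H 0) (hH0 : H 0 = 0) (hs : Function.Surjective (fderiv ℝ H 0))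
    (h : (fun z => ρ' (H z)) =O[𝓝[M] 0] fun z => ‖z‖ ^ k) :
    ∃ a : Cn N → Rn d →L[ℝ] Rn d, AnalyticAt ℝ a 0 ∧ IsUnit (a 0) ∧
      (fun z => ρ' (H z) - a z (ρ z)) =O[𝓝 0] fun z => ‖z‖ ^ k := by
  have hf : AnalyticAt ℝ (fun z => ρ' (H z)) 0 :=
    AnalyticAt.comp (by rw [hH0]; exact hρ'.analyticAt) hH
  obtain ⟨a, ha, haO⟩ := hρ.exists_division h0 hf h
  refine ⟨a, ha, ?_, haO⟩
  have h1 : HasFDerivAt (fun z => ρ' (H z)) ((fderiv ℝ ρ' 0).comp (fderiv ℝ H 0)) 0 := by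
    refine HasFDerivAt.comp 0 ?_ hH.differentiableAt.hasFDerivAt
    rw [hH0]
    exact hρ'.analyticAt.differentiableAt.hasFDerivAt
  have h2 := h1.sub (ha.differentiableAt.hasFDerivAt.clm_apply
    hρ.analyticAt.differentiableAt.hasFDerivAt)
  have h3 : HasFDerivAt (fun z => ρ' (H z) - a z (ρ z)) (0 : Cn N →L[ℝ] Rn d) 0 :=
    IsBigO.hasFDerivAt (by simpa using haO) hk
  have h4 := h2.unique h3
  have hsurj : Function.Surjective (a 0) := by
    intro y
    obtain ⟨v, hv⟩ := (hρ'.surjective.comp hs) y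
    refine ⟨fderiv ℝ ρ 0 v, ?_⟩
    have h5 := congrArg (fun f => f v) h4
    simp only [hρ.map_zero h0, sub_apply, ContinuousLinearMap.comp_apply, _root_.map_zero,
      add_zero, zero_apply, sub_eq_zero] at h5
    rw [← h5]
    exact hv
  exact ContinuousLinearMap.isUnit_iff_bijective.2
    ⟨(LinearMap.injective_iff_surjective (f := (a 0).toLinearMap)).2 hsurj, hsurj⟩

end RealFactor

section Complexification

open Filter Topology Asymptotics

variable {N d k : ℕ} {M M' U U' : Set (Cn N)} {ρ ρ' : Cn N → Rn d} {H : Cn N → Cn N}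
  {P P' : Cn N × Cn N → Fin d → ℂ}

theorem conjV_conjV (z : Cn N) : conjV N (conjV N z) = z := by
  ext i
  simp [conjV]

theorem norm_conjV (z : Cn N) : ‖conjV N z‖ = ‖z‖ := by
  simp [conjV, Pi.norm_def]

theorem conjV_zero : conjV N 0 = 0 := by
  ext i
  simp [conjV]

theorem norm_ofReal_pi (x : Rn d) : ‖(fun j => (x j : ℂ) : Fin d → ℂ)‖ = ‖x‖ := by
  simp [Pi.norm_def]

theorem tendsto_prodMk_conjV :
    Tendsto (fun z : Cn N => (z, conjV N z)) (𝓝 0) (𝓝 (0 : Cn N × Cn N)) := by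
  rw [tendsto_zero_iff_norm_tendsto_zero]
  simpa [Prod.norm_def, norm_conjV] using tendsto_norm_zero (E := Cn N)

theorem isBigO_conj_iff {G : Type} [NormedAddCommGroup G] [NormedSpace ℂ G] [CompleteSpace G]
    {R : Cn N × Cn N → G} (hR : AnalyticAt ℂ R (0, 0)) :
    ((fun z => R (z, conjV N z)) =O[𝓝 0] fun z => ‖z‖ ^ k) ↔ R =O[𝓝 0] fun w => ‖w‖ ^ k := by
  refine ⟨isBigO_of_isBigO_conj hR, fun h => ?_⟩
  simpa [Function.comp_def, Prod.norm_def, norm_conjV] using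
    h.comp_tendsto (tendsto_prodMk_conjV (N := N))

namespace IsComplexification

theorem eventually_eq (h : IsComplexification N d ρ P) :
    ∀ᶠ z in 𝓝 0, P (z, conjV N z) = fun j => (ρ z j : ℂ) := by
  obtain ⟨ε, hε, h⟩ := h.2
  filter_upwards [Metric.ball_mem_nhds 0 hε] with z hz
  exact funext (h z (by simpa using hz))

theorem exists_of_analyticAt (hρ : AnalyticAt ℝ ρ 0) : ∃ P, IsComplexification N d ρ P := by
  have hf : AnalyticAt ℝ (fun z j => (ρ z j : ℂ)) (0 : Cn N) := by
    refine analyticAt_pi_iff.2 fun j => ?_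
    exact (Complex.ofRealCLM.comp (ContinuousLinearMap.proj (R := ℝ) j)).analyticAt _ |>.comp hρ
  obtain ⟨P, hP, hPρ⟩ := exists_complexification hf
  obtain ⟨ε, hε, h⟩ := Metric.eventually_nhds_iff.1 hPρ
  exact ⟨P, hP, ε, hε, fun z hz => congrFun (h (by simpa using hz))⟩

theorem analyticAt_comp (h : IsComplexification N d ρ P) (hH : AnalyticAt ℂ H 0)
    (hH0 : H 0 = 0) :
    AnalyticAt ℂ (fun w : Cn N × Cn N => P (H w.1, conjMap N H w.2)) (0, 0) := by
  have h0 : conjMap N H 0 = 0 := by simp [conjMap, conjV_zero, hH0]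
  refine AnalyticAt.comp (g := P) (f := fun w : Cn N × Cn N => (H w.1, conjMap N H w.2)) ?_ ?_
  · simpa only [hH0, h0] using h.1
  · exact (AnalyticAt.comp (g := H) (f := Prod.fst) hH analyticAt_fst).prod
      (AnalyticAt.comp (g := conjMap N H) (f := Prod.snd) (analyticAt_conjMap hH) analyticAt_snd)

theorem eventually_comp_eq (h : IsComplexification N d ρ P) (hH : AnalyticAt ℂ H 0)
    (hH0 : H 0 = 0) :
    ∀ᶠ z in 𝓝 0, P (H z, conjMap N H (conjV N z)) = fun j => (ρ (H z) j : ℂ) := by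
  filter_upwards [(hH.tendsto_nhds_zero hH0).eventually h.eventually_eq] with z hz
  rw [conjMap, conjV_conjV, hz]

/-- The identity between complexifications holds to order `k` if it does on the diagonal. -/
theorem isBigO_sub_iff (h : IsComplexification N d ρ P) (h' : IsComplexification N d ρ' P')
    (hH : AnalyticAt ℂ H 0) (hH0 : H 0 = 0) :
    ((fun w => P' (H w.1, conjMap N H w.2) - P w) =O[𝓝 0] fun w => ‖w‖ ^ k) ↔
      (fun z => ρ' (H z) - ρ z) =O[𝓝 0] fun z => ‖z‖ ^ k := by
  rw [← isBigO_conj_iff (R := fun w => P' (H w.1, conjMap N H w.2) - P w)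
    ((h'.analyticAt_comp hH hH0).sub h.1), ← isBigO_norm_left,
    ← isBigO_norm_left (f' := fun z => ρ' (H z) - ρ z)]
  refine isBigO_congr ?_ .rfl
  filter_upwards [h.eventually_eq, h'.eventually_comp_eq hH hH0] with z h1 h2
  rw [h1, h2, ← norm_ofReal_pi]
  congr 1
  ext j
  simp

end IsComplexification

/-- Real factors relating `ρ' ∘ H` and `ρ` complexify to matrices of holomorphic functions. -/
theorem IsComplexification.exists_matrix (h : IsComplexification N d ρ P)
    (h' : IsComplexification N d ρ' P') (hH : AnalyticAt ℂ H 0) (hH0 : H 0 = 0)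
    {b : Cn N → Rn d →L[ℝ] Rn d} (hb : AnalyticAt ℝ b 0) (hb0 : IsUnit (b 0))
    (hO : (fun z => ρ' (H z) - b z (ρ z)) =O[𝓝 0] fun z => ‖z‖ ^ k) :
    ∃ a : Cn N × Cn N → Fin d → Fin d → ℂ, AnalyticAt ℂ a (0, 0) ∧
      (∀ᶠ w in 𝓝 0, IsUnit (Matrix.of (a w))) ∧
      (fun w => P' (H w.1, conjMap N H w.2) - (Matrix.of (a w)).mulVec (P w)) =O[𝓝 0]
        fun w => ‖w‖ ^ k := by
  have hf : AnalyticAt ℝ (fun z i j => ((b z (Pi.single j 1) i : ℝ) : ℂ)) (0 : Cn N) := by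
    refine analyticAt_pi_iff.2 fun i => analyticAt_pi_iff.2 fun j => ?_
    exact (Complex.ofRealCLM.comp ((ContinuousLinearMap.proj (R := ℝ) i).comp
      (ContinuousLinearMap.apply ℝ (Rn d) (Pi.single j (1 : ℝ) : Rn d)))).analyticAt _ |>.comp hb
  obtain ⟨a, ha, hab⟩ := exists_complexification hf
  refine ⟨a, ha, ?_, ?_⟩
  · have hc : ContinuousAt (fun w => (Matrix.of (a w)).det) 0 :=
      (Continuous.matrix_det (A := fun m : Fin d → Fin d → ℂ => Matrix.of m)
        continuous_id).continuousAt.comp ha.continuousAt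
    have h0 : (Matrix.of (a 0)).det ≠ 0 := by
      have h1 : Matrix.of (a 0) = (Complex.ofRealHom.mapMatrix
          (LinearMap.toMatrix' (b 0).toLinearMap)) := by
        have := hab.self_of_nhds
        rw [conjV_zero] at this
        ext i j
        simp only [Matrix.of_apply]
        rw [show a 0 = _ from this]
        simp [LinearMap.toMatrix'_apply]
      have h2 : IsUnit (b 0).toLinearMap :=
        hb0.map (ContinuousLinearMap.toLinearMapRingHom )
      rw [h1]
      exact ((Matrix.isUnit_iff_isUnit_det _).1 ((h2.map LinearMap.toMatrixAlgEquiv').map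
        Complex.ofRealHom.mapMatrix)).ne_zero
    filter_upwards [hc.eventually_ne h0] with w hw
    exact (Matrix.isUnit_iff_isUnit_det _).2 hw.isUnit
  · have hmul : AnalyticAt ℂ (fun w => (Matrix.of (a w)).mulVec (P w)) (0, 0) := by
      refine analyticAt_pi_iff.2 fun i => ?_
      simp only [Matrix.mulVec, dotProduct, Matrix.of_apply]
      refine Finset.analyticAt_fun_sum _ fun j _ => ?_
      exact (analyticAt_pi_iff.1 (analyticAt_pi_iff.1 ha i) j).mul (analyticAt_pi_iff.1 h.1 j)
    refine (isBigO_conj_iff ((h'.analyticAt_comp hH hH0).sub hmul)).1 ?_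
    rw [← isBigO_norm_left]
    rw [← isBigO_norm_left] at hO
    refine hO.congr' ?_ .rfl
    filter_upwards [h.eventually_eq, h'.eventually_comp_eq hH hH0, hab] with z h1 h2 h3
    simp only [Pi.sub_apply]
    rw [h1, h2, h3, ← norm_ofReal_pi]
    congr 1
    ext i
    have h4 : b z (ρ z) i = ∑ j, b z (Pi.single j 1) i * ρ z j := by
      conv_lhs => rw [← Finset.univ_sum_single (ρ z)]
      rw [map_sum, Finset.sum_apply]
      refine Finset.sum_congr rfl fun j _ => ?_
      rw [show (Pi.single j (ρ z j) : Rn d) = ρ z j • Pi.single j 1 by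
        rw [← Pi.single_smul, smul_eq_mul, mul_one], _root_.map_smul]
      simp [mul_comm]
    simp [h4, Matrix.mulVec, dotProduct]

/-- A holomorphic factor relating the complexifications gives vanishing along `M`. -/
theorem IsComplexification.isBigO_of_matrix (hρ : IsDefiningFun N d M 0 U ρ)
    (h : IsComplexification N d ρ P) (h' : IsComplexification N d ρ' P')
    (hH : AnalyticAt ℂ H 0) (hH0 : H 0 = 0) {a : Cn N × Cn N → Fin d → Fin d → ℂ}
    (hO : (fun w => P' (H w.1, conjMap N H w.2) - (Matrix.of (a w)).mulVec (P w)) =O[𝓝 0]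
        fun w => ‖w‖ ^ k) :
    (fun z => ρ' (H z)) =O[𝓝[M] 0] fun z => ‖z‖ ^ k := by
  have h1 := (hO.comp_tendsto (tendsto_prodMk_conjV (N := N))).mono
    (nhdsWithin_le_nhds (s := M))
  rw [← isBigO_norm_left] at h1 ⊢
  refine h1.congr' ?_ (.of_eq ?_)
  · rw [EventuallyEq, eventually_nhdsWithin_iff]
    filter_upwards [h.eventually_eq, h'.eventually_comp_eq hH hH0, hρ.eventually_mem_iff]
      with z h2 h3 h4 hz
    have h5 : P (z, conjV N z) = 0 := by
      rw [h2, h4.1 hz]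
      ext j
      simp
    simp only [Function.comp_apply]
    rw [h5, Matrix.mulVec_zero, sub_zero, h3, norm_ofReal_pi]
  · ext z
    simp [Prod.norm_def, norm_conjV]

end Complexification

section Equivalence

open Filter Topology Asymptotics

variable {N d k : ℕ} {M M' M'' U U' : Set (Cn N)} {ρ ρ' : Cn N → Rn d} {H H' : Cn N → Cn N}

theorem bijective_fderiv_real (hH : AnalyticAt ℂ H 0)
    (hb : Function.Bijective (fderiv ℂ H 0)) : Function.Bijective (fderiv ℝ H 0) := by
  rwa [(hH.differentiableAt.hasFDerivAt.restrictScalars ℝ).fderiv]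

theorem IsDefiningFun.exists_comp_sub_isBigO (hρ : IsDefiningFun N d M 0 U ρ) (h0 : 0 ∈ M)
    (hρ' : IsDefiningFun N d M' 0 U' ρ') (hk : 1 < k)
    (hH : AnalyticAt ℝ H 0) (hH0 : H 0 = 0) (hb : Function.Bijective (fderiv ℝ H 0))
    (h : (fun z => ρ' (H z)) =O[𝓝[M] 0] fun z => ‖z‖ ^ k) :
    ∃ V σ, IsDefiningFun N d M' 0 V σ ∧
      (fun z => σ (H z) - ρ z) =O[𝓝 0] fun z => ‖z‖ ^ k := by
  obtain ⟨a, ha, hu, haO⟩ := hρ.exists_isUnit_factor h0 hρ' hk hH hH0 hb.surjective h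
  obtain ⟨g, hg, hg0, hgH, -⟩ := hH.exists_local_inverse hb
  rw [hH0] at hg hg0
  have hi : AnalyticAt ℝ (fun z => Ring.inverse (a z)) 0 := by
    obtain ⟨u, hu⟩ := hu
    exact AnalyticAt.comp (g := Ring.inverse) (by rw [← hu]; exact analyticAt_inverse u) ha
  have hig : AnalyticAt ℝ (fun y => Ring.inverse (a (g y))) 0 :=
    AnalyticAt.comp (g := fun z => Ring.inverse (a z)) (by rwa [hg0]) hg
  have hσ : AnalyticAt ℝ (fun y => Ring.inverse (a (g y)) (ρ' y)) 0 :=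
    hig.continuousLinearMap_apply hρ'.analyticAt
  have hunit : ∀ᶠ z in 𝓝 0, IsUnit (a z) :=
    ha.continuousAt.eventually (Units.isOpen.mem_nhds hu)
  have hcancel : ∀ {T : Rn d →L[ℝ] Rn d}, IsUnit T → ∀ x, Ring.inverse T (T x) = x :=
    fun hT x => congrArg (fun f => f x) (Ring.inverse_mul_cancel _ hT)
  have hO : (fun z => Ring.inverse (a (g (H z))) (ρ' (H z)) - ρ z) =O[𝓝 0]
      fun z => ‖z‖ ^ k := by
    have h1 : (fun z => Ring.inverse (a z)) =O[𝓝 0] fun _ => (1 : ℝ) :=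
      hi.continuousAt.isBigO_one ℝ
    have h2 : (fun z => Ring.inverse (a z) (ρ' (H z) - a z (ρ z))) =O[𝓝 0]
        fun z => ‖Ring.inverse (a z)‖ * ‖ρ' (H z) - a z (ρ z)‖ :=
      isBigO_of_le _ fun z => by
        rw [Real.norm_of_nonneg (by positivity)]
        exact (Ring.inverse (a z)).le_opNorm _
    have h3 := h2.trans (h1.norm_left.mul haO.norm_left)
    simp only [one_mul] at h3
    refine h3.congr' ?_ .rfl
    filter_upwards [hgH, hunit] with z hz hz'
    rw [hz, _root_.map_sub, hcancel hz']
  have hs : Function.Surjective (fderiv ℝ (fun y => Ring.inverse (a (g y)) (ρ' y)) 0) := by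
    have h1 : HasFDerivAt (fun z => Ring.inverse (a (g (H z))) (ρ' (H z)))
        ((fderiv ℝ (fun y => Ring.inverse (a (g y)) (ρ' y)) 0).comp (fderiv ℝ H 0)) 0 := by
      refine HasFDerivAt.comp (g := fun y => Ring.inverse (a (g y)) (ρ' y)) 0 ?_
        hH.differentiableAt.hasFDerivAt
      rw [hH0]
      exact hσ.differentiableAt.hasFDerivAt
    have h2 := (h1.sub hρ.analyticAt.differentiableAt.hasFDerivAt).unique
      (IsBigO.hasFDerivAt (by simpa using hO) hk)
    rw [sub_eq_zero] at h2
    refine Function.Surjective.of_comp (g := fderiv ℝ H 0) ?_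
    rw [← ContinuousLinearMap.coe_comp, h2]
    exact hρ.surjective
  obtain ⟨V, hV⟩ := exists_isDefiningFun (M := M') hσ hs <| by
    filter_upwards [hρ'.eventually_mem_iff, (hg.tendsto_nhds_zero hg0).eventually hunit]
      with y hy hy'
    obtain ⟨u, hu⟩ := hy'
    rw [hy, ← hu, Ring.inverse_unit]
    refine ⟨fun h => by rw [h, _root_.map_zero], fun h => ?_⟩
    have h1 := congrArg (fun f => f (ρ' y)) u.mul_inv
    change u.val ((u⁻¹).val (ρ' y)) = ρ' y at h1
    rw [← h1, h, _root_.map_zero]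
  exact ⟨V, _, hV, hO⟩

theorem IsKEquivalence.inverse (h : IsKEquivalence N d M M' 0 0 k H) (hk : 1 < k)
    (hρ : IsDefiningFun N d M 0 U ρ) (h0 : 0 ∈ M)
    (hρ' : IsDefiningFun N d M' 0 U' ρ') (h0' : 0 ∈ M') {G : Cn N → Cn N}
    (hG : AnalyticAt ℂ G 0) (hGH : ∀ᶠ z in 𝓝 0, G (H z) = z) :
    IsKEquivalence N d M' M 0 0 k G := by
  obtain ⟨hH, hH0, hb, -⟩ := id h
  have hG0 : G 0 = 0 := by
    have := hGH.self_of_nhds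
    rwa [hH0] at this
  have hGb : Function.Bijective (fderiv ℂ G 0) := by
    have h1 : HasFDerivAt (fun z => G (H z)) ((fderiv ℂ G 0).comp (fderiv ℂ H 0)) 0 := by
      refine HasFDerivAt.comp 0 ?_ hH.differentiableAt.hasFDerivAt
      rw [hH0]
      exact hG.differentiableAt.hasFDerivAt
    have h2 := h1.unique ((hasFDerivAt_id (0 : Cn N)).congr_of_eventuallyEq hGH)
    rw [← Function.Bijective.of_comp_iff _ hb, ← ContinuousLinearMap.coe_comp, h2]
    exact Function.bijective_id
  have hHG : ∀ᶠ y in 𝓝 0, H (G y) = y := by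
    obtain ⟨g, hg, hg0, -, hHg⟩ := hH.exists_local_inverse hb
    rw [hH0] at hg hg0 hHg
    filter_upwards [hHg, (hg.tendsto_nhds_zero hg0).eventually hGH] with y hy hy'
    rw [hy] at hy'
    rw [hy', hy]
  refine isKEquivalence_of_isBigO hG hG0 hGb hρ' h0' fun V τ hτ => ?_
  obtain ⟨W, σ, hσ, hO⟩ := hτ.exists_comp_sub_isBigO h0 hρ' hk hH.restrictScalars hH0
    (bijective_fderiv_real hH hb) (h.isBigO hρ h0 hρ')
  rw [← nhdsWithin_univ] at hO
  have h1 := hO.comp_norm_pow (M := M') hG.restrictScalars hG0 (by simp)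
  refine h1.neg_left.congr' ?_ .rfl
  rw [EventuallyEq, eventually_nhdsWithin_iff]
  filter_upwards [hHG, hσ.eventually_mem_iff] with y hy hy' hyM
  simp [hy, hy'.1 hyM]

theorem IsKEquivalence.comp (h' : IsKEquivalence N d M' M'' 0 0 k H')
    (h : IsKEquivalence N d M M' 0 0 k H)
    (hρ : IsDefiningFun N d M 0 U ρ) (h0 : 0 ∈ M)
    (hρ' : IsDefiningFun N d M' 0 U' ρ') (h0' : 0 ∈ M') :
    IsKEquivalence N d M M'' 0 0 k (fun z => H' (H z)) := by
  obtain ⟨hH, hH0, hb, -⟩ := id h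
  obtain ⟨hH', hH'0, hb', -⟩ := id h'
  have hbc : Function.Bijective (fderiv ℂ (fun z => H' (H z)) 0) := by
    have h1 : HasFDerivAt (fun z => H' (H z)) ((fderiv ℂ H' 0).comp (fderiv ℂ H 0)) 0 := by
      refine HasFDerivAt.comp 0 ?_ hH.differentiableAt.hasFDerivAt
      rw [hH0]
      exact hH'.differentiableAt.hasFDerivAt
    rw [h1.fderiv]
    exact hb'.comp hb
  refine isKEquivalence_of_isBigO (AnalyticAt.comp (by rwa [hH0]) hH) (by simp [hH0, hH'0]) hbc
    hρ h0 fun V τ hτ => ?_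
  exact hρ'.isBigO_comp (f := fun z => τ (H' z)) h0' hH.restrictScalars hH0
    (h.isBigO hρ h0 hρ')
    (AnalyticAt.comp (by rw [hH'0]; exact hτ.analyticAt) hH'.restrictScalars)
    (h'.isBigO hρ' h0' hτ)

end Equivalence

open Filter Topology Asymptotics in
theorem statement4 (N d k : ℕ) (M M' : Set (Cn N))
    (hM : IsRASubmanifold N d M) (hM' : IsRASubmanifold N d M')
    (h0 : (0 : Cn N) ∈ M) (h0' : (0 : Cn N) ∈ M')
    (H : Cn N → Cn N) (hH : AnalyticAt ℂ H 0) (hH0 : H 0 = 0)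
    (hinv : Function.Bijective (fderiv ℂ H 0)) (hk : 1 < k) :
    [ -- (i) `H` is a `k`-equivalence between `(M,0)` and `(M',0)`
     IsKEquivalence N d M M' 0 0 k H,
     -- (ii) some parametrizations satisfy `Z'(x) = H(Z(x)) + O(|x|^k)`
     (∃ (Ω : Set (Rn (2*N - d))) (Z : Rn (2*N - d) → Cn N) (Ω' : Set (Rn (2*N - d))) (Z' : Rn (2*N - d) → Cn N),
       IsLocalParam N d M 0 Ω Z ∧ IsLocalParam N d M' 0 Ω' Z' ∧
       ∃ C ε : ℝ, 0 < ε ∧ ∀ x : Rn (2*N - d), ‖x‖ < ε →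
         ‖Z' x - H (Z x)‖ ≤ C * ‖x‖ ^ k),
     -- (iii) for every parametrization of `M` there is one of `M'` as in (ii)
     (∀ (Ω : Set (Rn (2*N - d))) (Z : Rn (2*N - d) → Cn N), IsLocalParam N d M 0 Ω Z →
       ∃ Ω' Z', IsLocalParam N d M' 0 Ω' Z' ∧
       ∃ C ε : ℝ, 0 < ε ∧ ∀ x : Rn (2*N - d), ‖x‖ < ε →
         ‖Z' x - H (Z x)‖ ≤ C * ‖x‖ ^ k),
     -- (iv) some defining functions satisfy `ρ'(H(Z),H̄(ζ)) = ρ(Z,ζ) + O(|(Z,ζ)|^k)`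
     (∃ (U : Set (Cn N)) (ρ : Cn N → Rn d) (U' : Set (Cn N)) (ρ' : Cn N → Rn d)
        (P P' : Cn N × Cn N → Fin d → ℂ),
       IsDefiningFun N d M 0 U ρ ∧ IsDefiningFun N d M' 0 U' ρ' ∧
       IsComplexification N d ρ P ∧ IsComplexification N d ρ' P' ∧
       ∃ C ε : ℝ, 0 < ε ∧ ∀ Z ζ : Cn N, ‖Z‖ < ε → ‖ζ‖ < ε →
         ‖(fun j => P' (H Z, conjMap N H ζ) j - P (Z, ζ) j : Fin d → ℂ)‖ ≤
           C * max ‖Z‖ ‖ζ‖ ^ k),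
     -- (v) for every defining function of `M` there is one of `M'` as in (iv)
     (∀ (U : Set (Cn N)) (ρ : Cn N → Rn d) (P : Cn N × Cn N → Fin d → ℂ),
       IsDefiningFun N d M 0 U ρ → IsComplexification N d ρ P →
       ∃ (U' : Set (Cn N)) (ρ' : Cn N → Rn d) (P' : Cn N × Cn N → Fin d → ℂ),
         IsDefiningFun N d M' 0 U' ρ' ∧ IsComplexification N d ρ' P' ∧
         ∃ C ε : ℝ, 0 < ε ∧ ∀ Z ζ : Cn N, ‖Z‖ < ε → ‖ζ‖ < ε →
           ‖(fun j => P' (H Z, conjMap N H ζ) j - P (Z, ζ) j : Fin d → ℂ)‖ ≤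
             C * max ‖Z‖ ‖ζ‖ ^ k),
     -- (vi) for any defining functions there is an invertible-matrix-valued factor `a`
     (∀ (U : Set (Cn N)) (ρ : Cn N → Rn d) (P : Cn N × Cn N → Fin d → ℂ)
        (U' : Set (Cn N)) (ρ' : Cn N → Rn d) (P' : Cn N × Cn N → Fin d → ℂ),
       IsDefiningFun N d M 0 U ρ → IsComplexification N d ρ P →
       IsDefiningFun N d M' 0 U' ρ' → IsComplexification N d ρ' P' →
       ∃ a : Cn N × Cn N → Fin d → Fin d → ℂ,
         AnalyticAt ℂ a (0, 0) ∧
         (∃ ε : ℝ, 0 < ε ∧ ∀ w : Cn N × Cn N, ‖w‖ < ε → IsUnit (Matrix.of (a w))) ∧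
         ∃ C ε : ℝ, 0 < ε ∧ ∀ Z ζ : Cn N, ‖Z‖ < ε → ‖ζ‖ < ε →
           ‖(fun j => P' (H Z, conjMap N H ζ) j -
               (Matrix.of (a (Z, ζ))).mulVec (fun j' => P (Z, ζ) j') j : Fin d → ℂ)‖ ≤
             C * max ‖Z‖ ‖ζ‖ ^ k)].TFAE ∧
    -- in particular, inverses of `k`-equivalences are `k`-equivalences
    (IsKEquivalence N d M M' 0 0 k H →
      ∀ Hinv : Cn N → Cn N, AnalyticAt ℂ Hinv 0 →
        (∀ᶠ z in nhds (0 : Cn N), Hinv (H z) = z) →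
        IsKEquivalence N d M' M 0 0 k Hinv) ∧
    -- and compositions of `k`-equivalences are `k`-equivalences
    (∀ (M'' : Set (Cn N)) (H' : Cn N → Cn N), IsRASubmanifold N d M'' →
      IsKEquivalence N d M M' 0 0 k H → IsKEquivalence N d M' M'' 0 0 k H' →
      IsKEquivalence N d M M'' 0 0 k (fun z => H' (H z))) := by
  have hH' := hH.restrictScalars (𝕜 := ℝ)
  have hb := bijective_fderiv_real hH hinv
  obtain ⟨U₀, ρ₀, hρ₀⟩ := hM 0 h0
  obtain ⟨U₀', ρ₀', hρ₀'⟩ := hM' 0 h0'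
  have kEquiv_of_isBigO : ∀ U' ρ', IsDefiningFun N d M' 0 U' ρ' →
      ((fun z => ρ' (H z)) =O[𝓝[M] 0] fun z => ‖z‖ ^ k) → IsKEquivalence N d M M' 0 0 k H := by
    intro U' ρ' hρ' hO
    exact isKEquivalence_of_isBigO hH hH0 hinv hρ₀ h0 fun V τ hτ =>
      hρ'.isBigO_comp h0' hH' hH0 hO hτ.analyticAt hτ.isBigO_self
  refine ⟨?_, fun h G hG hGH => h.inverse hk hρ₀ h0 hρ₀' h0' hG hGH,
    fun M'' H' _ h h' => h'.comp h hρ₀ h0 hρ₀' h0'⟩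
  tfae_have 1 → 3 := by
    intro h Ω Z hZ
    obtain ⟨Ω', Z', hZ', hO⟩ := hZ.exists_sub_isBigO hρ₀' h0' hk hH' hH0 hb.injective
      (h.isBigO hρ₀ h0 hρ₀')
    exact ⟨Ω', Z', hZ', isBigO_norm_pow_iff.1 hO⟩
  tfae_have 3 → 2 := by
    intro h
    obtain ⟨Ω, Z, hZ⟩ := hρ₀.exists_isLocalParam h0
    obtain ⟨Ω', Z', hZ', hO⟩ := h Ω Z hZ
    exact ⟨Ω, Z, Ω', Z', hZ, hZ', hO⟩
  tfae_have 2 → 1 := by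
    rintro ⟨Ω, Z, Ω', Z', hZ, hZ', hO⟩
    exact ⟨hH, hH0, hinv, Ω, Z, hZ, fun U' ρ' hρ' => isBigO_norm_pow_iff.1
      (hZ.isBigO_of_sub_isBigO hZ' hρ' hH' hH0 (isBigO_norm_pow_iff.2 hO))⟩
  tfae_have 1 → 5 := by
    intro h U ρ P hρ hP
    obtain ⟨V, σ, hσ, hO⟩ := hρ.exists_comp_sub_isBigO h0 hρ₀' hk hH' hH0 hb
      (h.isBigO hρ h0 hρ₀')
    obtain ⟨Q, hQ⟩ := IsComplexification.exists_of_analyticAt hσ.analyticAt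
    exact ⟨V, σ, Q, hσ, hQ, isBigO_norm_pow_prod_iff.1 ((hP.isBigO_sub_iff hQ hH hH0).2 hO)⟩
  tfae_have 5 → 4 := by
    intro h
    obtain ⟨P, hP⟩ := IsComplexification.exists_of_analyticAt hρ₀.analyticAt
    obtain ⟨U', ρ', P', hρ', hP', hO⟩ := h U₀ ρ₀ P hρ₀ hP
    exact ⟨U₀, ρ₀, U', ρ', P, P', hρ₀, hρ', hP, hP', hO⟩
  tfae_have 4 → 1 := by
    rintro ⟨U, ρ, U', ρ', P, P', hρ, hρ', hP, hP', hO⟩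
    have h1 := (hP.isBigO_sub_iff hP' hH hH0).1 (isBigO_norm_pow_prod_iff.2 hO)
    refine kEquiv_of_isBigO U' ρ' hρ' ?_
    refine ((h1.mono nhdsWithin_le_nhds).add hρ.isBigO_self).congr_left fun z => ?_
    abel
  tfae_have 1 → 6 := by
    intro h U ρ P U' ρ' P' hρ hP hρ' hP'
    obtain ⟨b, hb', hu, hO⟩ := hρ.exists_isUnit_factor h0 hρ' hk hH' hH0 hb.surjective
      (h.isBigO hρ h0 hρ')
    obtain ⟨a, ha, hau, haO⟩ := hP.exists_matrix hP' hH hH0 hb' hu hO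
    obtain ⟨ε, hε, hau⟩ := Metric.eventually_nhds_iff.1 hau
    exact ⟨a, ha, ⟨ε, hε, fun w hw => hau (by simpa using hw)⟩, isBigO_norm_pow_prod_iff.1 haO⟩
  tfae_have 6 → 1 := by
    intro h
    obtain ⟨P, hP⟩ := IsComplexification.exists_of_analyticAt hρ₀.analyticAt
    obtain ⟨P', hP'⟩ := IsComplexification.exists_of_analyticAt hρ₀'.analyticAt
    obtain ⟨a, -, -, hO⟩ := h U₀ ρ₀ P U₀' ρ₀' P' hρ₀ hP hρ₀' hP'
    exact kEquiv_of_isBigO U₀' ρ₀' hρ₀' (hP.isBigO_of_matrix hρ₀ hP' hH hH0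
      (isBigO_norm_pow_prod_iff.2 hO))
  tfae_finish
end
end

section
/- Let (v_α(x))_{α∈A} be a collection of real-analytic ℂ^K-valued functions in a neighborhood of 0 in ℝ^m. If the dimension of the span in ℂ^K of the vectors v_α(x), α ∈ A, is not constant for x in any neighborhood of 0, then there exists an integer κ > 1 such that, for any other collection (v'_α(x))_{α∈A} of real-analytic ℂ^K-valued functions in some neighborhood of 0 with v'_α(x) = v_α(x) + O(|x|^κ) for each α, the dimension of the span in ℂ^K of the v'_α(x) is also nonconstant in any neighborhood of 0. -/
open scoped BigOperators

noncomputable section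

/-- The dimension of the complex span of the values `v α x`, `α ∈ A`, at the point `x`. -/
def spanDim (m K : ℕ) {A : Type*} (v : A → (Fin m → ℝ) → (Fin K → ℂ))
    (x : Fin m → ℝ) : ℕ :=
  Module.finrank ℂ (Submodule.span ℂ (Set.range fun α => v α x))

open Asymptotics Filter Topology
open scoped ContDiff

/-- An analytic function vanishing to every finite order at a point vanishes near that point. -/
theorem AnalyticAt.eventually_eq_zero_of_forall_isBigO {𝕜 E F : Type*}
    [NontriviallyNormedField 𝕜] [NormedAddCommGroup E] [NormedSpace 𝕜 E]
    [NormedAddCommGroup F] [NormedSpace 𝕜 F] {f : E → F} (hf : AnalyticAt 𝕜 f 0)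
    (h : ∀ n : ℕ, f =O[𝓝 0] fun x => ‖x‖ ^ n) : ∀ᶠ x in 𝓝 0, f x = 0 := by
  obtain ⟨p, hp⟩ := hf
  have hterm : ∀ n, ∀ y : E, (p n fun _ => y) = 0 := by
    intro n
    induction n using Nat.strong_induction_on with
    | _ k hk =>
      have hsum : p.partialSum (k + 1) = fun y => p k fun _ => y := by
        funext z
        rw [FormalMultilinearSeries.partialSum, Finset.sum_range_succ,
          Finset.sum_eq_zero fun b hb => hk b (Finset.mem_range.mp hb) z, zero_add]
      have hp' := hp.isBigO_sub_partialSum_pow (k + 1)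
      simp only [hsum, zero_add] at hp'
      have hk' : (fun y => p k fun _ => y) =O[𝓝 0] fun y => ‖y‖ ^ (k + 1) :=
        ((h (k + 1)).sub hp').congr_left fun y => by simp
      exact hk'.continuousMultilinearMap_apply_eq_zero
  filter_upwards [hp.eventually_hasSum] with y hy
  simp only [hterm, zero_add] at hy
  exact hy.unique hasSum_zero

/-- The determinant of the images of `n` vectors under a linear map to an `n`-dimensional
coordinate space. -/
def coordDet {K n : ℕ} (L : (Fin K → ℂ) →ₗ[ℂ] (Fin n → ℂ)) (w : Fin n → Fin K → ℂ) : ℂ :=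
  (Matrix.of fun i j => L (w i) j).det

theorem contDiff_coordDet {K n : ℕ} (L : (Fin K → ℂ) →ₗ[ℂ] (Fin n → ℂ)) :
    ContDiff ℝ ω (coordDet L) := by
  have hL : ∀ i j : Fin n, ContDiff ℝ ω fun w : Fin n → Fin K → ℂ => L (w i) j := fun i j =>
    (((LinearMap.proj j ∘ₗ L ∘ₗ LinearMap.proj i :
      (Fin n → Fin K → ℂ) →ₗ[ℂ] ℂ).restrictScalars ℝ).toContinuousLinearMap).contDiff
  have hdet : coordDet L = fun w => ∑ σ : Equiv.Perm (Fin n),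
      (Equiv.Perm.sign σ : ℤ) • ∏ i, L (w (σ i)) i := by
    funext w
    simp [coordDet, Matrix.det_apply, Units.smul_def]
  rw [hdet]
  simp only [zsmul_eq_mul]
  exact ContDiff.sum fun σ _ => contDiff_const.mul (contDiff_prod fun i _ => hL (σ i) i)

theorem le_spanDim_of_coordDet_ne_zero {m K n : ℕ} {A : Type*}
    {v : A → (Fin m → ℝ) → (Fin K → ℂ)} {x : Fin m → ℝ} {a : Fin n → A}
    {L : (Fin K → ℂ) →ₗ[ℂ] (Fin n → ℂ)} (h : coordDet L (fun i => v (a i) x) ≠ 0) :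
    n ≤ spanDim m K v x := by
  have hli : LinearIndependent ℂ fun i => v (a i) x :=
    LinearIndependent.of_comp L (Matrix.linearIndependent_rows_of_det_ne_zero h)
  calc n = Module.finrank ℂ (Submodule.span ℂ (Set.range fun i => v (a i) x)) := by
        rw [finrank_span_eq_card hli, Fintype.card_fin]
    _ ≤ spanDim m K v x := Submodule.finrank_mono <| Submodule.span_mono <|
        Set.range_subset_iff.mpr fun i => ⟨a i, rfl⟩

theorem exists_coordDet_ne_zero_of_le_spanDim {m K n : ℕ} {A : Type*}
    {v : A → (Fin m → ℝ) → (Fin K → ℂ)} {x : Fin m → ℝ} (h : n ≤ spanDim m K v x) :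
    ∃ (a : Fin n → A) (L : (Fin K → ℂ) →ₗ[ℂ] (Fin n → ℂ)),
      coordDet L (fun i => v (a i) x) ≠ 0 := by
  obtain ⟨f, hf, -, hli⟩ := Submodule.exists_fun_fin_finrank_span_eq ℂ (Set.range fun α => v α x)
  choose b hb using hf
  obtain rfl : (fun i => v (b i) x) = f := funext hb
  have hli' : LinearIndependent ℂ fun i : Fin n => v (b (Fin.castLE h i)) x :=
    hli.comp (Fin.castLE h) (Fin.castLE_injective h)
  obtain ⟨L, hL⟩ := LinearMap.exists_leftInverse_of_injective _
    (LinearMap.ker_eq_bot.mpr hli'.fintypeLinearCombination_injective)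
  refine ⟨fun i => b (Fin.castLE h i), L, ?_⟩
  have hone : (Matrix.of fun i j => L (v (b (Fin.castLE h i)) x) j) =
      (1 : Matrix (Fin n) (Fin n) ℂ) := by
    ext i j
    have hi := congrFun (LinearMap.congr_fun hL (Pi.single i 1)) j
    simpa [Fintype.linearCombination_apply_single, Matrix.one_apply, Pi.single_apply,
      eq_comm] using hi
  simp [coordDet, hone]

theorem analyticAt_coordDet_comp {m K n : ℕ} {A : Type*}
    {v : A → (Fin m → ℝ) → (Fin K → ℂ)} {x : Fin m → ℝ} (hv : ∀ α, AnalyticAt ℝ (v α) x)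
    (a : Fin n → A) (L : (Fin K → ℂ) →ₗ[ℂ] (Fin n → ℂ)) :
    AnalyticAt ℝ (fun y => coordDet L fun i => v (a i) y) x :=
  ((contDiff_coordDet L).analyticOnNhd _ (Set.mem_univ _)).comp
    (AnalyticAt.pi fun i => hv (a i))

theorem isBigO_coordDet_sub {m K n : ℕ} {A : Type*}
    {v v' : A → (Fin m → ℝ) → (Fin K → ℂ)} {x : Fin m → ℝ} {g : (Fin m → ℝ) → ℝ}
    (hv : ∀ α, ContinuousAt (v α) x) (hv' : ∀ α, ContinuousAt (v' α) x)
    (hx : ∀ α, v' α x = v α x) (h : ∀ α, (fun y => v' α y - v α y) =O[𝓝 x] g)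
    (a : Fin n → A) (L : (Fin K → ℂ) →ₗ[ℂ] (Fin n → ℂ)) :
    (fun y => coordDet L (fun i => v' (a i) y) - coordDet L fun i => v (a i) y) =O[𝓝 x] g := by
  have hlip := (((contDiff_coordDet L).contDiffAt (x := fun i => v (a i) x)).hasStrictFDerivAt
    (by simp)).isBigO_sub
  have hlim : Tendsto (fun y => ((fun i => v' (a i) y : Fin n → Fin K → ℂ), fun i => v (a i) y))
      (𝓝 x) (𝓝 ((fun i => v (a i) x), fun i => v (a i) x)) := by
    refine Tendsto.prodMk_nhds (tendsto_pi_nhds.mpr fun i => ?_)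
      (tendsto_pi_nhds.mpr fun i => hv (a i))
    rw [← hx]
    exact hv' (a i)
  exact (hlip.comp_tendsto hlim).trans (isBigO_pi.mpr fun i => h (a i))

/-- The dimension of the span is lower semicontinuous. -/
theorem eventually_spanDim_le {m K : ℕ} {A : Type*}
    {v : A → (Fin m → ℝ) → (Fin K → ℂ)} {x : Fin m → ℝ} (hv : ∀ α, AnalyticAt ℝ (v α) x) :
    ∀ᶠ y in 𝓝 x, spanDim m K v x ≤ spanDim m K v y := by
  obtain ⟨a, L, hdet⟩ := exists_coordDet_ne_zero_of_le_spanDim (le_refl (spanDim m K v x))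
  filter_upwards [(analyticAt_coordDet_comp hv a L).continuousAt.eventually_ne hdet] with y hy
  exact le_spanDim_of_coordDet_ne_zero hy

theorem statement5 (m K : ℕ) {A : Type*} (v : A → (Fin m → ℝ) → (Fin K → ℂ))
    (U : Set (Fin m → ℝ)) (hU : IsOpen U) (h0 : (0 : Fin m → ℝ) ∈ U)
    (hv : ∀ α, AnalyticOnNhd ℝ (v α) U)
    -- the dimension of the span of the `v α x` is not constant in any neighborhood of `0`
    (hnc : ∀ W : Set (Fin m → ℝ), IsOpen W → (0 : Fin m → ℝ) ∈ W →
      ∃ x ∈ W ∩ U, ∃ y ∈ W ∩ U, spanDim m K v x ≠ spanDim m K v y) :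
    ∃ κ : ℕ, 1 < κ ∧
      ∀ (U' : Set (Fin m → ℝ)) (v' : A → (Fin m → ℝ) → (Fin K → ℂ)),
        IsOpen U' → (0 : Fin m → ℝ) ∈ U' → (∀ α, AnalyticOnNhd ℝ (v' α) U') →
        (∀ α, ∃ C ε : ℝ, 0 < ε ∧ ∀ x : Fin m → ℝ, ‖x‖ < ε →
          ‖v' α x - v α x‖ ≤ C * ‖x‖ ^ κ) →
        ∀ W : Set (Fin m → ℝ), IsOpen W → (0 : Fin m → ℝ) ∈ W →
          ∃ x ∈ W ∩ U', ∃ y ∈ W ∩ U', spanDim m K v' x ≠ spanDim m K v' y := by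
  obtain ⟨r, hr, hball⟩ := Metric.isOpen_iff.mp hU 0 h0
  obtain ⟨z, hz, hlt⟩ : ∃ z ∈ Metric.ball (0 : Fin m → ℝ) r,
      spanDim m K v 0 < spanDim m K v z := by
    obtain ⟨W, hW, hWo, h0W⟩ :=
      eventually_nhds_iff.mp (eventually_spanDim_le fun α => hv α 0 h0)
    obtain ⟨x, hx, y, hy, hxy⟩ := hnc (W ∩ Metric.ball 0 r) (hWo.inter Metric.isOpen_ball)
      ⟨h0W, Metric.mem_ball_self hr⟩
    by_contra! hcon
    exact hxy (((hcon x hx.1.2).antisymm (hW x hx.1.1)).trans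
      ((hcon y hy.1.2).antisymm (hW y hy.1.1)).symm)
  obtain ⟨a, L, hdet⟩ := exists_coordDet_ne_zero_of_le_spanDim (Nat.succ_le_of_lt hlt)
  have hnz : ¬ ∀ᶠ x in 𝓝 0, coordDet L (fun i => v (a i) x) = 0 := fun hcon =>
    hdet <| AnalyticOnNhd.eqOn_zero_of_preconnected_of_eventuallyEq_zero (𝕜 := ℝ)
      (fun x hx => analyticAt_coordDet_comp (fun α => hv α x (hball hx)) a L)
      (convex_ball (0 : Fin m → ℝ) r).isPreconnected (Metric.mem_ball_self hr) hcon hz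
  obtain ⟨k, hk⟩ := not_forall.mp <| mt
    (analyticAt_coordDet_comp (fun α => hv α 0 h0) a L).eventually_eq_zero_of_forall_isBigO hnz
  refine ⟨k + 2, by omega, fun U' v' hU' h0' hv' hclose W hW h0W => ?_⟩
  have heq : ∀ α, v' α 0 = v α 0 := by
    intro α
    obtain ⟨C, ε, hε, hC⟩ := hclose α
    simpa [sub_eq_zero] using hC 0 (by simpa using hε)
  have hbig : ∀ α, (fun x => v' α x - v α x) =O[𝓝 0] fun x => ‖x‖ ^ k := by
    intro α
    obtain ⟨C, ε, hε, hC⟩ := hclose α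
    have hpow : (fun x : Fin m → ℝ => ‖x‖ ^ (k + 2)) =O[𝓝 0] fun x => ‖x‖ ^ k := by
      refine IsBigO.of_bound 1 ?_
      filter_upwards [Metric.ball_mem_nhds (0 : Fin m → ℝ) one_pos] with x hx
      simpa using pow_le_pow_of_le_one (norm_nonneg x) (mem_ball_zero_iff.mp hx).le
        (Nat.le_add_right k 2)
    refine (IsBigO.of_bound C ?_).trans hpow
    filter_upwards [Metric.ball_mem_nhds (0 : Fin m → ℝ) hε] with x hx
    simpa using hC x (by simpa using hx)
  have hdim : spanDim m K v' 0 = spanDim m K v 0 := by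
    rw [spanDim, spanDim, funext heq]
  have hfreq : ∃ᶠ x in 𝓝 0, coordDet L (fun i => v' (a i) x) ≠ 0 := by
    intro hcon
    have hdiff := isBigO_coordDet_sub (fun α => (hv α 0 h0).continuousAt)
      (fun α => (hv' α 0 h0').continuousAt) heq hbig a L
    refine hk (hdiff.neg_left.congr' ?_ EventuallyEq.rfl)
    filter_upwards [hcon] with x hx
    simp [not_not.mp hx]
  obtain ⟨x, hx, hxW⟩ := (hfreq.and_eventually ((hW.inter hU').mem_nhds ⟨h0W, h0'⟩)).exists
  refine ⟨0, ⟨h0W, h0'⟩, x, hxW, ?_⟩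
  rw [hdim]
  exact (Nat.lt_of_succ_le (le_spanDim_of_coordDet_ne_zero hx)).ne
end
end

section
/- Let M_1, M'_1 ⊂ ℂ^{N_1} be two generic real-analytic submanifolds through 0 of the same dimension. Let M := M_1 × {0} and M' := M'_1 × {0}, both contained in ℂ^N = ℂ^{N_1} × ℂ^{N_2}, and let H be a k-equivalence between (M,0) and (M',0) with k > 1. Write Z = (Z^1,Z^2) and H = (H^1,H^2) according to the decomposition ℂ^{N_1} × ℂ^{N_2}. Then H^2(Z^1,0) = O(|Z^1|^k) and Z^1 ↦ H^1(Z^1,0) is a k-equivalence between (M_1,0) and (M'_1,0). -/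
open scoped BigOperators
open Complex

noncomputable section

/-- The Wirtinger derivative `∂g/∂Z_i` of a complex-valued function at `z`. -/
def wirtD (N : ℕ) (g : Cn N → ℂ) (z : Cn N) (i : Fin N) : ℂ :=
  (1/2) * (fderiv ℝ g z (Pi.single i 1) - Complex.I * fderiv ℝ g z (Pi.single i Complex.I))

/-- The complex gradient `ρ^j_Z(p,p̄)` of a real-valued component of a defining function. -/
def cxGrad (N : ℕ) (f : Cn N → ℝ) (p : Cn N) : Cn N :=
  fun i => wirtD N (fun z => (f z : ℂ)) p i

/-- `M` is a generic real-analytic submanifold of codimension `d`. -/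
def IsGenericSubmanifold (N d : ℕ) (M : Set (Cn N)) : Prop :=
  IsRASubmanifold N d M ∧
  ∀ p ∈ M, ∀ (U : Set (Cn N)) (ρ : Cn N → Rn d), IsDefiningFun N d M p U ρ →
    LinearIndependent ℂ (fun j : Fin d => cxGrad N (fun z => ρ z j) p)

/-- The embedding `ℂ^{N₁} ∋ Z¹ ↦ (Z¹,0) ∈ ℂ^{N₁} × ℂ^{N₂}`. -/
def emb12 (N₁ N₂ : ℕ) (z : Cn N₁) : Cn (N₁ + N₂) := Fin.append z 0

/-- The projection onto the first factor `ℂ^{N₁}`. -/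
def proj1 (N₁ N₂ : ℕ) (w : Cn (N₁ + N₂)) : Cn N₁ := fun i => w (Fin.castAdd N₂ i)

/-- The projection onto the second factor `ℂ^{N₂}`. -/
def proj2 (N₁ N₂ : ℕ) (w : Cn (N₁ + N₂)) : Cn N₂ := fun j => w (Fin.natAdd N₁ j)

/-- The submanifold `M₁ × {0} ⊂ ℂ^{N₁} × ℂ^{N₂}`. -/
def prodWithZero (N₁ N₂ : ℕ) (M₁ : Set (Cn N₁)) : Set (Cn (N₁ + N₂)) :=
  {w | proj1 N₁ N₂ w ∈ M₁ ∧ proj2 N₁ N₂ w = 0}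

open Filter Topology Asymptotics

section Jets

variable {E F G : Type*} [NormedAddCommGroup E] [NormedSpace ℂ E] [NormedAddCommGroup F]
  [NormedSpace ℂ F] [NormedAddCommGroup G] [NormedSpace ℝ G]

/-- A homogeneous term of a power series vanishes at `v + Complex.I • w` once it vanishes at all real
combinations `v + t • w`. -/
theorem homogeneous_apply_add_I_smul_eq_zero {n : ℕ} (q : E [×n]→L[ℂ] F) (v w : E)
    (h : ∀ t : ℝ, q (fun _ => v + (t : ℂ) • w) = 0) : q (fun _ => v + Complex.I • w) = 0 := by
  have han : AnalyticOnNhd ℂ (fun c : ℂ => q (fun _ => v + c • w)) Set.univ := by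
    intro c _
    have h1 : AnalyticAt ℂ (fun c : ℂ => (fun _ : Fin n => v + c • w)) c := by
      rw [analyticAt_pi_iff]
      intro _
      fun_prop
    exact AnalyticAt.comp (f := fun c : ℂ => (fun _ : Fin n => v + c • w)) q.analyticAt h1
  have hfreq : ∃ᶠ c in 𝓝[≠] (0 : ℂ), q (fun _ => v + c • w) = 0 := by
    have ht : Tendsto (fun t : ℝ => (t : ℂ)) (𝓝[≠] 0) (𝓝[≠] 0) := by
      refine tendsto_nhdsWithin_iff.2 ⟨?_, ?_⟩
      · exact (Complex.continuous_ofReal.tendsto' 0 0 (by simp)).mono_left nhdsWithin_le_nhds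
      · filter_upwards [self_mem_nhdsWithin] with t ht
        simpa using ht
    exact ht.frequently (Eventually.of_forall h).frequently
  exact han.eqOn_zero_of_preconnected_of_frequently_eq_zero isPreconnected_univ
    (Set.mem_univ _) hfreq (Set.mem_univ I)

/-- If `f` is holomorphic and `f ∘ Z` vanishes to order `k`, where the image of the differential
of `Z` spans the whole space over `ℂ`, then `f` vanishes to order `k`. -/
theorem isBigO_pow_of_comp_isBigO_pow [NormedSpace ℝ E] [IsScalarTower ℝ ℂ E]
    {f : E → F} {Z : G → E} {Z' : G →L[ℝ] E} {k : ℕ}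
    (hf : AnalyticAt ℂ f 0) (hZ : HasFDerivAt Z Z' 0) (hZ0 : Z 0 = 0)
    (hspan : ∀ z, ∃ u v, z = Z' u + Complex.I • Z' v)
    (hO : (fun x => f (Z x)) =O[𝓝 0] fun x => ‖x‖ ^ k) :
    f =O[𝓝 0] fun z => ‖z‖ ^ k := by
  obtain ⟨p, hp⟩ := hf
  have hreal : ∀ (t : ℝ) (x : E), (t : ℂ) • x = t • x := fun t x => algebraMap_smul ℂ t x
  have hvanish : ∀ n, n < k → ∀ z, p n (fun _ => z) = 0 := by
    intro n
    induction n using Nat.strong_induction_on with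
    | _ n ih =>
    intro hn
    have hT : ∀ u, p n (fun _ => Z' u) = 0 := by
      intro u
      have hd : HasDerivAt (fun t : ℝ => Z (t • u)) (Z' u) 0 := by
        have h1 : HasDerivAt (fun t : ℝ => t • u) u 0 := by
          simpa using (hasDerivAt_id (0 : ℝ)).smul_const u
        have h2 : HasFDerivAt Z Z' ((0 : ℝ) • u) := by simpa using hZ
        exact h2.comp_hasDerivAt (0 : ℝ) h1
      have hslope : Tendsto (fun t : ℝ => t⁻¹ • Z (t • u)) (𝓝[≠] 0) (𝓝 (Z' u)) := by
        simpa [hZ0] using hasDerivAt_iff_tendsto_slope_zero.1 hd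
      have hlim : Tendsto (fun t : ℝ => p n (fun _ => t⁻¹ • Z (t • u))) (𝓝[≠] 0)
          (𝓝 (p n (fun _ => Z' u))) :=
        ((p n).cont.tendsto _).comp (tendsto_pi_nhds.2 fun _ => hslope)
      have hu : Tendsto (fun t : ℝ => t • u) (𝓝 0) (𝓝 0) :=
        (continuous_id.smul continuous_const).tendsto' _ _ (by simp)
      have huO : (fun t : ℝ => t • u) =O[𝓝 0] fun t : ℝ => t := by
        refine IsBigO.of_bound ‖u‖ (Eventually.of_forall fun t => ?_)
        rw [norm_smul, mul_comm]
      have hZt : Tendsto (fun t : ℝ => Z (t • u)) (𝓝 0) (𝓝 0) :=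
        hd.continuousAt.tendsto.trans (by simp [hZ0])
      have hZO : (fun t : ℝ => Z (t • u)) =O[𝓝 0] fun t : ℝ => t := by
        simpa [hZ0] using hd.isBigO_sub
      have h1 : (fun t : ℝ => f (Z (t • u))) =O[𝓝 0] fun t : ℝ => t ^ (n + 1) := by
        refine ((hO.comp_tendsto hu).trans (huO.norm_left.pow k)).trans ?_
        refine IsBigO.of_bound 1 ?_
        filter_upwards [Metric.ball_mem_nhds (0 : ℝ) one_pos] with t ht
        have ht1 : |t| ≤ 1 := by simpa using (mem_ball_zero_iff.1 ht).le
        simpa using pow_le_pow_of_le_one (abs_nonneg t) ht1 hn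
      have h2 : (fun t : ℝ => f (Z (t • u)) - p n (fun _ => Z (t • u))) =O[𝓝 0]
          fun t : ℝ => t ^ (n + 1) := by
        have h3 := (hp.isBigO_sub_partialSum_pow (n + 1)).comp_tendsto hZt
        have h4 : ∀ y, p.partialSum (n + 1) y = p n (fun _ => y) := by
          intro y
          rw [FormalMultilinearSeries.partialSum, Finset.sum_range_succ,
            Finset.sum_eq_zero, zero_add]
          intro m hm
          exact ih m (Finset.mem_range.1 hm) ((Finset.mem_range.1 hm).trans hn) y
        simp only [Function.comp_def, zero_add, h4] at h3
        exact h3.trans (hZO.norm_left.pow (n + 1))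
      have h5 : (fun t : ℝ => p n (fun _ => Z (t • u))) =O[𝓝[≠] 0] fun t : ℝ => t ^ (n + 1) := by
        simpa using (h1.sub h2).mono nhdsWithin_le_nhds
      have h6 : (fun t : ℝ => p n (fun _ => t⁻¹ • Z (t • u))) =O[𝓝[≠] 0] fun t : ℝ => t := by
        have h7 := (isBigO_refl (fun t : ℝ => ((t : ℂ)⁻¹) ^ n) (𝓝[≠] 0)).smul
            (g' := fun t : ℝ => (t : ℂ) ^ (n + 1)) (h5.trans (IsBigO.of_bound 1 (by simp)))
        refine (h7.congr' ?_ EventuallyEq.rfl).trans ?_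
        · filter_upwards with t
          have : (fun _ : Fin n => t⁻¹ • Z (t • u)) =
              fun i : Fin n => (fun _ => ((t : ℂ)⁻¹)) i • (fun _ => Z (t • u)) i := by
            funext _
            rw [← Complex.ofReal_inv, hreal]
          rw [this, (p n).map_smul_univ]
          simp
        · refine IsBigO.of_bound 1 ?_
          filter_upwards [self_mem_nhdsWithin] with t ht
          have ht' : |t| ≠ 0 := by simpa using ht
          rw [norm_smul]
          simp only [norm_pow, norm_inv, Complex.norm_real, Real.norm_eq_abs, one_mul]
          rw [pow_succ, ← mul_assoc, ← mul_pow, inv_mul_cancel₀ ht', one_pow, one_mul]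
      have h8 : Tendsto (fun t : ℝ => p n (fun _ => t⁻¹ • Z (t • u))) (𝓝[≠] 0) (𝓝 0) :=
        h6.trans_tendsto (tendsto_id.mono_left nhdsWithin_le_nhds)
      exact tendsto_nhds_unique hlim h8
    intro z
    obtain ⟨u, v, rfl⟩ := hspan z
    refine homogeneous_apply_add_I_smul_eq_zero (p n) _ _ fun t => ?_
    simpa only [map_add, map_smul, hreal] using hT (u + t • v)
  have h := hp.isBigO_sub_partialSum_pow k
  have h4 : ∀ y, p.partialSum k y = 0 := fun y =>
    Finset.sum_eq_zero fun m hm => hvanish m (Finset.mem_range.1 hm) y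
  simpa [h4] using h

end Jets

/-- The tangent space of a generic submanifold spans the ambient space over `ℂ`. -/
theorem exists_add_I_smul_of_linearIndependent_cxGrad {N d : ℕ} {ρ : Cn N → Rn d} {p : Cn N}
    (hρ : DifferentiableAt ℝ ρ p)
    (hli : LinearIndependent ℂ (fun j : Fin d => cxGrad N (fun z => ρ z j) p)) (z : Cn N) :
    ∃ u v, fderiv ℝ ρ p u = 0 ∧ fderiv ℝ ρ p v = 0 ∧ z = u + Complex.I • v := by
  set R : Cn N →L[ℝ] Rn d := fderiv ℝ ρ p with hR
  let S : Submodule ℂ (Cn N) :=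
    { carrier := {z | ∃ u v, R u = 0 ∧ R v = 0 ∧ z = u + Complex.I • v}
      zero_mem' := ⟨0, 0, by simp⟩
      add_mem' := by
        rintro _ _ ⟨u, v, hu, hv, rfl⟩ ⟨u', v', hu', hv', rfl⟩
        refine ⟨u + u', v + v', by simp [hu, hu'], by simp [hv, hv'], ?_⟩
        rw [smul_add]; abel
      smul_mem' := by
        rintro c _ ⟨u, v, hu, hv, rfl⟩
        refine ⟨c.re • u - c.im • v, c.re • v + c.im • u, by simp [hu, hv], by simp [hu, hv], ?_⟩
        funext i
        apply Complex.ext <;> simp <;> ring }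
  suffices hS : S = ⊤ by
    have : z ∈ S := hS ▸ Submodule.mem_top
    exact this
  by_contra hne
  obtain ⟨L, hL0, hL⟩ := Submodule.exists_le_ker_of_lt_top S (lt_top_iff_ne_top.2 hne)
  let r : Fin d → Module.Dual ℝ (Cn N) := fun j =>
    (LinearMap.proj j).comp (R : Cn N →ₗ[ℝ] Rn d)
  have hker : ∀ g : ℂ →ₗ[ℝ] ℝ,
      (g.comp (L.restrictScalars ℝ) : Module.Dual ℝ (Cn N)) ∈ Submodule.span ℝ (Set.range r) := by
    intro g
    apply mem_span_of_iInf_ker_le_ker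
    intro u hu
    have hu0 : R u = 0 := by
      funext j
      simpa [r] using (Submodule.mem_iInf _).1 hu j
    have : u ∈ S := ⟨u, 0, hu0, by simp, by simp⟩
    have hLu : L u = 0 := hL this
    simp [hLu]
  obtain ⟨a, ha⟩ := (Submodule.mem_span_range_iff_exists_fun ℝ).1 (hker Complex.reLm)
  obtain ⟨b, hb⟩ := (Submodule.mem_span_range_iff_exists_fun ℝ).1 (hker Complex.imLm)
  have hre : ∀ v, (L v).re = ∑ j, a j * R v j := fun v => by
    simpa [r] using (LinearMap.congr_fun ha v).symm
  have him : ∀ v, (L v).im = ∑ j, b j * R v j := fun v => by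
    simpa [r] using (LinearMap.congr_fun hb v).symm
  have hgrad : ∀ j i, cxGrad N (fun z => ρ z j) p i =
      (1 / 2) * ((R (Pi.single i 1) j : ℂ) - I * (R (Pi.single i I) j : ℂ)) := by
    intro j i
    have h1 : HasFDerivAt (fun z => ((ρ z j : ℝ) : ℂ))
        (Complex.ofRealCLM.comp ((ContinuousLinearMap.proj j).comp R)) p :=
      Complex.ofRealCLM.hasFDerivAt.comp p ((hasFDerivAt_pi'.1 hρ.hasFDerivAt) j)
    simp only [cxGrad, wirtD, h1.fderiv]
    simp
  have hI : ∀ i : Fin N, (Pi.single i I : Cn N) = Complex.I • Pi.single i 1 := fun i => by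
    rw [← Pi.single_smul]; simp
  have hzero : ∑ j, ((a j : ℂ) - I * b j) • cxGrad N (fun z => ρ z j) p = 0 := by
    funext i
    have e1 := hre (Pi.single i 1)
    have e2 := him (Pi.single i 1)
    have e3 := hre (Pi.single i I)
    have e4 := him (Pi.single i I)
    have hLI : L (Pi.single i I) = I * L (Pi.single i 1) := by rw [hI, map_smul, smul_eq_mul]
    have f3 : (L (Pi.single i I)).re = -(L (Pi.single i 1)).im := by rw [hLI]; simp
    have f4 : (L (Pi.single i I)).im = (L (Pi.single i 1)).re := by rw [hLI]; simp
    have key : ∑ j, ((a j : ℂ) - I * b j) * cxGrad N (fun z => ρ z j) p i =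
        (1 / 2) * ((((∑ j, a j * R (Pi.single i 1) j : ℝ) : ℂ)
          - I * ((∑ j, b j * R (Pi.single i 1) j : ℝ) : ℂ))
          - I * ((((∑ j, a j * R (Pi.single i I) j : ℝ) : ℂ)
          - I * ((∑ j, b j * R (Pi.single i I) j : ℝ) : ℂ)))) := by
      push_cast
      simp only [Finset.mul_sum, ← Finset.sum_sub_distrib, hgrad]
      refine Finset.sum_congr rfl fun j _ => ?_
      ring
    rw [Finset.sum_apply]
    simp only [Pi.smul_apply, smul_eq_mul, Pi.zero_apply]
    rw [key, ← e1, ← e2, ← e3, ← e4, f3, f4]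
    apply Complex.ext <;> simp
  have hc := Fintype.linearIndependent_iff.1 hli _ hzero
  have ha0 : ∀ j, a j = 0 := fun j => by simpa using congrArg Complex.re (hc j)
  have hb0 : ∀ j, b j = 0 := fun j => by simpa using congrArg Complex.im (hc j)
  refine hL0 (LinearMap.ext fun v => ?_)
  apply Complex.ext
  · rw [hre]; simp [ha0]
  · rw [him]; simp [hb0]

/-- `proj1` as a continuous linear map. -/
def proj1L (N₁ N₂ : ℕ) : Cn (N₁ + N₂) →L[ℂ] Cn N₁ :=
  ContinuousLinearMap.pi fun i => ContinuousLinearMap.proj (Fin.castAdd N₂ i)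

/-- `proj2` as a continuous linear map. -/
def proj2L (N₁ N₂ : ℕ) : Cn (N₁ + N₂) →L[ℂ] Cn N₂ :=
  ContinuousLinearMap.pi fun j => ContinuousLinearMap.proj (Fin.natAdd N₁ j)

theorem proj1_emb12 (N₁ N₂ : ℕ) (z : Cn N₁) : proj1 N₁ N₂ (emb12 N₁ N₂ z) = z := by
  funext i; simp [proj1, emb12]

theorem proj2_emb12 (N₁ N₂ : ℕ) (z : Cn N₁) : proj2 N₁ N₂ (emb12 N₁ N₂ z) = 0 := by
  funext i; simp [proj2, emb12]

theorem append_proj1_proj2 (N₁ N₂ : ℕ) (w : Cn (N₁ + N₂)) :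
    Fin.append (proj1 N₁ N₂ w) (proj2 N₁ N₂ w) = w :=
  Fin.append_castAdd_natAdd

theorem emb12_proj1 {N₁ N₂ : ℕ} {w : Cn (N₁ + N₂)} (h : proj2 N₁ N₂ w = 0) :
    emb12 N₁ N₂ (proj1 N₁ N₂ w) = w := by
  rw [emb12, ← h, append_proj1_proj2]

/-- `emb12` as a continuous linear map. -/
def emb12L (N₁ N₂ : ℕ) : Cn N₁ →L[ℂ] Cn (N₁ + N₂) :=
  LinearMap.toContinuousLinearMap
    { toFun := emb12 N₁ N₂
      map_add' := fun x y => by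
        funext i
        refine Fin.addCases (fun i => ?_) (fun i => ?_) i <;> simp [emb12]
      map_smul' := fun c x => by
        funext i
        refine Fin.addCases (fun i => ?_) (fun i => ?_) i <;> simp [emb12] }

/-- A defining function of `M₁` extends to one of `M₁ × {0}`. -/
theorem IsDefiningFun.prodWithZero {N₁ N₂ d : ℕ} {M₁ : Set (Cn N₁)} {U : Set (Cn N₁)}
    {ρ : Cn N₁ → Rn d} (h : IsDefiningFun N₁ d M₁ 0 U ρ)
    (e : (Rn d × Cn N₂) ≃L[ℝ] Rn (d + 2 * N₂)) :
    IsDefiningFun (N₁ + N₂) (d + 2 * N₂) (prodWithZero N₁ N₂ M₁) 0 (proj1 N₁ N₂ ⁻¹' U)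
      (fun w => e (ρ (proj1 N₁ N₂ w), proj2 N₁ N₂ w)) := by
  obtain ⟨hU, h0, han, hM, hsurj⟩ := h
  refine ⟨hU.preimage (proj1L N₁ N₂).continuous, h0, ?_, ?_, ?_⟩
  · intro w hw
    have h1 : AnalyticAt ℝ (fun w => ρ (proj1 N₁ N₂ w)) w :=
      AnalyticAt.comp (f := proj1 N₁ N₂) (han _ hw)
        (((proj1L N₁ N₂).restrictScalars ℝ).analyticAt w)
    exact (e.toContinuousLinearMap.analyticAt _).comp
      (h1.prod (((proj2L N₁ N₂).restrictScalars ℝ).analyticAt w))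
  · intro w hw
    have := hM _ hw
    rw [EmbeddingLike.map_eq_zero_iff, Prod.mk_eq_zero, ← this]
    rfl
  · intro w hw
    have hd : HasFDerivAt ρ (fderiv ℝ ρ (proj1 N₁ N₂ w)) (proj1 N₁ N₂ w) :=
      (han _ hw).differentiableAt.hasFDerivAt
    have h1 := hd.comp w ((proj1L N₁ N₂).restrictScalars ℝ).hasFDerivAt
    have h2 := e.toContinuousLinearMap.hasFDerivAt.comp w
      (h1.prodMk ((proj2L N₁ N₂).restrictScalars ℝ).hasFDerivAt)
    have h3 : fderiv ℝ (fun w => e (ρ (proj1 N₁ N₂ w), proj2 N₁ N₂ w)) w = _ := h2.fderiv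
    rw [h3]
    intro y
    obtain ⟨⟨a, b⟩, rfl⟩ := e.surjective y
    obtain ⟨v, rfl⟩ := hsurj _ hw a
    refine ⟨Fin.append v b, ?_⟩
    have e1 : proj1L N₁ N₂ (Fin.append v b) = v := by funext i; simp [proj1L]
    have e2 : proj2L N₁ N₂ (Fin.append v b) = b := by funext i; simp [proj2L]
    simp [e1, e2]

/-- A local parametrization of `M₁ × {0}` induces one of `M₁`. -/
theorem IsLocalParam.proj1 {N₁ N₂ d : ℕ} {M₁ : Set (Cn N₁)}
    {Ω : Set (Rn (2 * (N₁ + N₂) - (d + 2 * N₂)))}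
    {Z : Rn (2 * (N₁ + N₂) - (d + 2 * N₂)) → Cn (N₁ + N₂)}
    (h : IsLocalParam (N₁ + N₂) (d + 2 * N₂) (prodWithZero N₁ N₂ M₁) 0 Ω Z)
    (e : Rn (2 * N₁ - d) ≃L[ℝ] Rn (2 * (N₁ + N₂) - (d + 2 * N₂))) :
    IsLocalParam N₁ d M₁ 0 (e ⁻¹' Ω) (fun x => proj1 N₁ N₂ (Z (e x))) := by
  obtain ⟨hΩ, h0, hZ0, han, hinj, hder, U, hU, h0U, himg⟩ := h
  have hmem : ∀ x ∈ Ω, Z x ∈ _root_.prodWithZero N₁ N₂ M₁ ∩ U := fun x hx =>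
    himg ▸ Set.mem_image_of_mem Z hx
  have hemb : ∀ x ∈ Ω, emb12 N₁ N₂ (_root_.proj1 N₁ N₂ (Z x)) = Z x := fun x hx =>
    emb12_proj1 (hmem x hx).1.2
  have han' : AnalyticOnNhd ℝ (fun x => _root_.proj1 N₁ N₂ (Z (e x))) (e ⁻¹' Ω) := fun x hx =>
    (((proj1L N₁ N₂).restrictScalars ℝ).analyticAt _).comp
      (AnalyticAt.comp (f := e) (han _ hx) (e.toContinuousLinearMap.analyticAt x))
  refine ⟨hΩ.preimage e.continuous, by simpa using h0, by simp [hZ0]; rfl, han', ?_, ?_,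
    emb12 N₁ N₂ ⁻¹' U, hU.preimage (emb12L N₁ N₂).continuous, ?_, ?_⟩
  · intro x hx y hy hxy
    apply e.injective
    apply hinj hx hy
    rw [← hemb _ hx, ← hemb _ hy]
    exact congrArg _ hxy
  · intro x hx
    have h1 := ((emb12L N₁ N₂).restrictScalars ℝ).hasFDerivAt.comp x
      (han' x hx).differentiableAt.hasFDerivAt
    have h2 : HasFDerivAt (fun x => Z (e x)) ((fderiv ℝ Z (e x)).comp e.toContinuousLinearMap) x :=
      (han _ hx).differentiableAt.hasFDerivAt.comp x e.toContinuousLinearMap.hasFDerivAt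
    have heq : (fun x => Z (e x)) =ᶠ[𝓝 x]
        ((emb12L N₁ N₂).restrictScalars ℝ) ∘ fun x => _root_.proj1 N₁ N₂ (Z (e x)) := by
      filter_upwards [(hΩ.preimage e.continuous).mem_nhds hx] with y hy
      exact (hemb _ hy).symm
    have h3 := h2.unique (h1.congr_of_eventuallyEq heq)
    have h4 : Function.Injective ((fderiv ℝ Z (e x)).comp e.toContinuousLinearMap) :=
      (hder _ hx).comp e.injective
    rw [h3] at h4
    exact Function.Injective.of_comp (f := (emb12L N₁ N₂).restrictScalars ℝ) h4
  · have : emb12 N₁ N₂ 0 = 0 := (emb12L N₁ N₂).map_zero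
    simpa [this] using h0U
  · ext z
    constructor
    · rintro ⟨x, hx, rfl⟩
      refine ⟨(hmem _ hx).1.1, ?_⟩
      simpa [hemb _ hx] using (hmem _ hx).2
    · rintro ⟨hz, hzU⟩
      have : emb12 N₁ N₂ z ∈ Z '' Ω := by
        rw [himg]
        exact ⟨⟨by simpa [proj1_emb12] using hz, proj2_emb12 _ _ _⟩, hzU⟩
      obtain ⟨x, hx, hxz⟩ := this
      exact ⟨e.symm x, by simpa using hx, by simp [hxz, proj1_emb12]⟩

/-- The image of the differential of a local parametrization is the kernel of the differential
of any defining function. -/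
theorem IsLocalParam.mem_range_fderiv {N d : ℕ} {M : Set (Cn N)} {p : Cn N}
    {Ω : Set (Rn (2 * N - d))} {Z : Rn (2 * N - d) → Cn N} (hZ : IsLocalParam N d M p Ω Z)
    {U : Set (Cn N)} {ρ : Cn N → Rn d} (hρ : IsDefiningFun N d M p U ρ) {u : Cn N}
    (hu : fderiv ℝ ρ p u = 0) : ∃ x, fderiv ℝ Z 0 x = u := by
  obtain ⟨hΩ, h0, rfl, han, -, hder, V, -, -, himg⟩ := hZ
  obtain ⟨hU, h0U, hρan, hM, hsurj⟩ := hρ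
  have hcomp : (fderiv ℝ ρ (Z 0)).comp (fderiv ℝ Z 0) = 0 := by
    have h1 := (hρan _ h0U).differentiableAt.hasFDerivAt.comp (0 : Rn (2 * N - d))
      (han _ h0).differentiableAt.hasFDerivAt
    refine h1.unique ((hasFDerivAt_const (0 : Rn d) _).congr_of_eventuallyEq ?_)
    filter_upwards [hΩ.mem_nhds h0, (han _ h0).continuousAt (hU.mem_nhds h0U)] with x hx hxU
    have : Z x ∈ M ∩ V := himg ▸ Set.mem_image_of_mem Z hx
    exact (hM _ hxU).1 this.1
  set A : Rn (2 * N - d) →ₗ[ℝ] Cn N := (fderiv ℝ Z 0 : Rn (2 * N - d) →ₗ[ℝ] Cn N)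
  set B : Cn N →ₗ[ℝ] Rn d := (fderiv ℝ ρ (Z 0) : Cn N →ₗ[ℝ] Rn d)
  have hle : LinearMap.range A ≤ LinearMap.ker B := by
    rintro _ ⟨x, rfl⟩
    exact DFunLike.congr_fun hcomp x
  have hA : Module.finrank ℝ (LinearMap.range A) = 2 * N - d := by
    rw [LinearMap.finrank_range_of_inj (f := A) (hder _ h0)]
    simp
  have hB : Module.finrank ℝ (LinearMap.ker B) = 2 * N - d := by
    have h1 := LinearMap.finrank_range_add_finrank_ker B
    rw [LinearMap.range_eq_top.2 (hsurj _ h0U), finrank_top] at h1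
    have h2 : Module.finrank ℝ (Cn N) = 2 * N := by
      rw [finrank_real_of_complex]; simp
    rw [h2] at h1
    simp at h1
    omega
  have heq := Submodule.eq_of_le_of_finrank_eq hle (hA.trans hB.symm)
  have : u ∈ LinearMap.range A := heq ▸ hu
  exact this

theorem statement6 (N₁ N₂ d k : ℕ) (M₁ M₁' : Set (Cn N₁))
    (h₁ : IsGenericSubmanifold N₁ d M₁) (h₁' : IsGenericSubmanifold N₁ d M₁')
    (h0 : (0 : Cn N₁) ∈ M₁) (h0' : (0 : Cn N₁) ∈ M₁') (hk : 1 < k)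
    (H : Cn (N₁ + N₂) → Cn (N₁ + N₂))
    (hH : IsKEquivalence (N₁ + N₂) (d + 2 * N₂) (prodWithZero N₁ N₂ M₁)
      (prodWithZero N₁ N₂ M₁') 0 0 k H) :
    (∃ C ε : ℝ, 0 < ε ∧ ∀ z : Cn N₁, ‖z‖ < ε →
      ‖proj2 N₁ N₂ (H (emb12 N₁ N₂ z))‖ ≤ C * ‖z‖ ^ k) ∧
    IsKEquivalence N₁ d M₁ M₁' 0 0 k (fun z => proj1 N₁ N₂ (H (emb12 N₁ N₂ z))) := by
  obtain ⟨hHan, hH0, hHbij, Ω, Z, hZ, hest⟩ := hH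
  have emb0 : emb12 N₁ N₂ 0 = 0 := (emb12L N₁ N₂).map_zero
  let e : (Rn d × Cn N₂) ≃L[ℝ] Rn (d + 2 * N₂) := ContinuousLinearEquiv.ofFinrankEq (by
    rw [Module.finrank_prod, finrank_real_of_complex]; simp)
  let s : Rn (2 * N₁ - d) ≃L[ℝ] Rn (2 * (N₁ + N₂) - (d + 2 * N₂)) :=
    ContinuousLinearEquiv.ofFinrankEq (by simp; omega)
  have hZ₁ := hZ.proj1 s
  set Z₁ : Rn (2 * N₁ - d) → Cn N₁ := fun x => proj1 N₁ N₂ (Z (s x)) with hZ₁def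
  obtain ⟨hΩ₁, h0Ω₁, hZ₁0, hZ₁an, -⟩ := id hZ₁
  have hembZ : ∀ x, s x ∈ Ω → emb12 N₁ N₂ (Z₁ x) = Z (s x) := by
    intro x hx
    obtain ⟨-, -, -, -, -, -, U, -, -, himg⟩ := hZ
    have : Z (s x) ∈ prodWithZero N₁ N₂ M₁ ∩ U := himg ▸ Set.mem_image_of_mem Z hx
    exact emb12_proj1 this.1.2
  have hO : ∀ U' ρ', IsDefiningFun N₁ d M₁' 0 U' ρ' →
      (fun x => ((ρ' (proj1 N₁ N₂ (H (emb12 N₁ N₂ (Z₁ x)))),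
        proj2 N₁ N₂ (H (emb12 N₁ N₂ (Z₁ x)))) : Rn d × Cn N₂)) =O[𝓝 0] fun x => ‖x‖ ^ k := by
    intro U' ρ' hρ'
    obtain ⟨C, ε, hε, hb⟩ := hest _ _ (hρ'.prodWithZero e)
    have h1 : (fun y => e (ρ' (proj1 N₁ N₂ (H (Z y))), proj2 N₁ N₂ (H (Z y)))) =O[𝓝 0]
        fun y => ‖y‖ ^ k := by
      refine IsBigO.of_bound C ?_
      filter_upwards [Metric.ball_mem_nhds 0 hε] with y hy
      simpa using hb y (by simpa using hy)
    have hs : Tendsto s (𝓝 0) (𝓝 0) := s.continuous.tendsto' _ _ (by simp)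
    have h2 := (e.symm.toContinuousLinearMap.isBigO_comp _ _).trans (h1.comp_tendsto hs)
    have h3 : (fun x => ‖s x‖ ^ k) =O[𝓝 0] fun x => ‖x‖ ^ k :=
      ((s.toContinuousLinearMap.isBigO_id (𝓝 0)).norm_norm).pow k
    refine (h2.trans h3).congr' ?_ EventuallyEq.rfl
    filter_upwards [hΩ₁.mem_nhds h0Ω₁] with x hx
    simp [hembZ x hx]
  obtain ⟨U, ρ, hρ⟩ := h₁.1 0 h0
  obtain ⟨U', ρ', hρ'⟩ := h₁'.1 0 h0'
  have hHan' : AnalyticAt ℂ (fun z => H (emb12 N₁ N₂ z)) 0 :=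
    AnalyticAt.comp (f := emb12 N₁ N₂) (by rwa [emb0]) ((emb12L N₁ N₂).analyticAt 0)
  have han1 : AnalyticAt ℂ (fun z => proj1 N₁ N₂ (H (emb12 N₁ N₂ z))) 0 :=
    ((proj1L N₁ N₂).analyticAt _).comp hHan'
  have han2 : AnalyticAt ℂ (fun z => proj2 N₁ N₂ (H (emb12 N₁ N₂ z))) 0 :=
    ((proj2L N₁ N₂).analyticAt _).comp hHan'
  have hmain : (fun z => proj2 N₁ N₂ (H (emb12 N₁ N₂ z))) =O[𝓝 0] fun z => ‖z‖ ^ k := by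
    refine isBigO_pow_of_comp_isBigO_pow han2
      (hZ₁an _ h0Ω₁).differentiableAt.hasFDerivAt hZ₁0 ?_
      (hO U' ρ' hρ').prod_left_snd
    intro z
    obtain ⟨u, v, hu, hv, rfl⟩ := exists_add_I_smul_of_linearIndependent_cxGrad
      (hρ.2.2.1 _ hρ.2.1).differentiableAt (h₁.2 0 h0 U ρ hρ) z
    obtain ⟨x, rfl⟩ := hZ₁.mem_range_fderiv hρ hu
    obtain ⟨y, rfl⟩ := hZ₁.mem_range_fderiv hρ hv
    exact ⟨x, y, rfl⟩
  refine ⟨?_, han1, ?_, ?_, _, _, hZ₁, ?_⟩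
  · obtain ⟨C, hC⟩ := hmain.bound
    obtain ⟨ε, hε, hb⟩ := Metric.eventually_nhds_iff.1 hC
    exact ⟨C, ε, hε, fun z hz => by simpa using hb (y := z) (by simpa using hz)⟩
  · simp only [emb0, hH0]
    rfl
  · have hd : HasFDerivAt (fun z => H (emb12 N₁ N₂ z)) ((fderiv ℂ H 0).comp (emb12L N₁ N₂)) 0 := by
      have h1 : HasFDerivAt H (fderiv ℂ H 0) (emb12L N₁ N₂ 0) := by
        rw [map_zero]; exact hHan.differentiableAt.hasFDerivAt
      exact h1.comp 0 (emb12L N₁ N₂).hasFDerivAt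
    have hd1 := (proj1L N₁ N₂).hasFDerivAt.comp (0 : Cn N₁) hd
    have hd2 := (proj2L N₁ N₂).hasFDerivAt.comp (0 : Cn N₁) hd
    have hd2' : HasFDerivAt (fun z => proj2 N₁ N₂ (H (emb12 N₁ N₂ z)))
        (0 : Cn N₁ →L[ℂ] Cn N₂) 0 :=
      IsBigO.hasFDerivAt (n := k) (by simpa using hmain) hk
    have hz := hd2.unique hd2'
    have hfd : fderiv ℂ (fun z => proj1 N₁ N₂ (H (emb12 N₁ N₂ z))) 0 = _ := hd1.fderiv
    rw [hfd]
    have hinj : Function.Injective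
        ((proj1L N₁ N₂).comp ((fderiv ℂ H 0).comp (emb12L N₁ N₂))) := by
      rw [injective_iff_map_eq_zero]
      intro v hv
      have hw2 : proj2 N₁ N₂ (fderiv ℂ H 0 (emb12 N₁ N₂ v)) = 0 := DFunLike.congr_fun hz v
      have hw1 : proj1 N₁ N₂ (fderiv ℂ H 0 (emb12 N₁ N₂ v)) = 0 := hv
      have hw : fderiv ℂ H 0 (emb12 N₁ N₂ v) = 0 := by
        rw [← emb12_proj1 hw2, hw1, emb0]
      have hv0 : emb12 N₁ N₂ v = 0 := hHbij.1 (by rw [hw, map_zero])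
      rw [← proj1_emb12 N₁ N₂ v, hv0]
      rfl
    exact ⟨hinj, LinearMap.surjective_of_injective
      (f := ((proj1L N₁ N₂).comp ((fderiv ℂ H 0).comp (emb12L N₁ N₂))).toLinearMap) hinj⟩
  · intro V' σ hσ
    obtain ⟨C, hC⟩ := (hO V' σ hσ).prod_left_fst.bound
    obtain ⟨ε, hε, hb⟩ := Metric.eventually_nhds_iff.1 hC
    exact ⟨C, ε, hε, fun x hx => by simpa using hb (y := x) (by simpa using hx)⟩
end
end
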